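/- arXiv:0906.2364 — 3 statements merged into one kernel-verified Lean document; each statement's English description precedes it below -/
import Mathlib

section
/- For every prime p, the fraction field of the ring of p-typical Witt vectors over an algebraic closure F̄_p of the field with p elements is C₁: every homogeneous polynomial over this field of degree d in n variables with n > d has a nontrivial zero. -/
namespace LangC1
open MvPolynomial in
/-- Fewer equations than variables, all vanishing at the origin: there is a nontrivial zero. -/
theorem exists_nontrivial_zero {k : Type*} [Field k] [IsAlgClosed k] {σ : Type*} [Finite σ]
    {m : ℕ} (φ : Fin m → MvPolynomial σ k) (h0 : ∀ j, eval 0 (φ j) = 0)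
    (hm : m < Nat.card σ) : ∃ a : σ → k, a ≠ 0 ∧ ∀ j, eval a (φ j) = 0 := by
  classical
  by_contra hcon
  push Not at hcon
  have key : ringKrullDim (MvPolynomial σ k) ≤ m := by
    rw [ringKrullDim_le_iff_isMaximal_height_le]
    intro M hM
    obtain ⟨a, ha⟩ := eq_vanishingIdeal_singleton_of_isMaximal k hM
    let ψ : Fin m → MvPolynomial σ k := fun j => bind₁ (fun i => X i - C (a i)) (φ j)
    have hψ : ∀ (b : σ → k) j, eval b (ψ j) = eval (b - a) (φ j) := by
      intro b j
      have : (eval b).comp (bind₁ (fun i => X i - C (a i)) : _ →ₐ[k] MvPolynomial σ k).toRingHom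
          = eval (b - a) := by
        ext <;> simp
      exact congrArg (fun g : MvPolynomial σ k →+* k => g (φ j)) this
    have hz : zeroLocus k (Ideal.span (Set.range ψ)) = {a} := by
      rw [zeroLocus_span]
      ext b
      simp only [Set.mem_range, forall_exists_index, forall_apply_eq_imp_iff, Set.mem_ofPred_eq,
        Set.mem_singleton_iff, aeval_eq_eval, hψ]
      constructor
      · intro h
        by_contra hb
        obtain ⟨j, hj⟩ := hcon (b - a) (sub_ne_zero.mpr hb)
        exact hj (h j)
      · rintro rfl j
        rw [sub_self]; exact h0 j
    have hrad : (Ideal.span (Set.range ψ)).radical = M := by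
      rw [← vanishingIdeal_zeroLocus_eq_radical (K := k), hz, ha]
    have hmin : M ∈ (Ideal.span (Set.range ψ)).minimalPrimes := by
      rw [← Ideal.radical_minimalPrimes, hrad, Ideal.minimalPrimes_eq_subsingleton_self]
      rfl
    have h1 := Ideal.height_le_card_of_mem_minimalPrimes_span (Set.finite_range ψ) hmin
    have h2 : (Set.range ψ).ncard ≤ m := by
      rw [← Set.image_univ]
      refine (Set.ncard_image_le).trans ?_
      simp
    have h3 : M.height ≤ (m : ℕ∞) := h1.trans (by exact_mod_cast h2)
    exact_mod_cast h3
  rw [MvPolynomial.ringKrullDim_of_isNoetherianRing] at key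
  simp only [ringKrullDim_eq_zero_of_field, zero_add] at key
  have : Nat.card σ ≤ m := by exact_mod_cast key
  omega

open Polynomial Ring in
/-- The Hensel lemma without the monic hypothesis. -/
theorem hensel_unit {R : Type*} [CommRing R] (I : Ideal R)
    [IsAdicComplete I R] (f : R[X]) (a₀ : R) (h₁ : f.eval a₀ ∈ I)
    (h₂ : IsUnit (f.derivative.eval a₀)) : ∃ a, f.eval a = 0 ∧ a - a₀ ∈ I := by
  classical
  replace h₂ : IsUnit (Ideal.Quotient.mk I (f.derivative.eval a₀)) := h₂.map _
  let f' := derivative f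
  let c : ℕ → R := fun n => Nat.recOn n a₀ fun _ b => b - f.eval b * (f'.eval b)⁻¹ʳ
  have hc : ∀ n, c (n + 1) = c n - f.eval (c n) * (f'.eval (c n))⁻¹ʳ := by
    intro n
    simp only [c]
  have hc_mod : ∀ n, c n ≡ a₀ [SMOD I] := by
    intro n
    induction n with
    | zero => rfl
    | succ n ih => ?_
    rw [hc, sub_eq_add_neg, ← add_zero a₀]
    refine ih.add ?_
    rw [SModEq.zero, Ideal.neg_mem_iff]
    refine I.mul_mem_right _ ?_
    rw [← SModEq.zero] at h₁ ⊢
    exact (ih.eval f).trans h₁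
  have hf'c : ∀ n, IsUnit (f'.eval (c n)) := by
    intro n
    have := isLocalHom_of_le_jacobson_bot I (IsAdicComplete.le_jacobson_bot I)
    apply IsUnit.of_map (Ideal.Quotient.mk I)
    convert! h₂ using 1
    exact SModEq.def.mp ((hc_mod n).eval _)
  have hfcI : ∀ n, f.eval (c n) ∈ I ^ (n + 1) := by
    intro n
    induction n with
    | zero => simpa only [Nat.rec_zero, zero_add, pow_one] using! h₁
    | succ n ih => ?_
    obtain ⟨q, hq⟩ := f.exists_mul_sq_add_linear_part_eq_eval_add (c n)
      (-(f.eval (c n) * (f'.eval (c n))⁻¹ʳ))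
    rw [hc, sub_eq_add_neg, ← hq]
    have h3 : f.derivative.eval (c n) * (-(f.eval (c n) * (f'.eval (c n))⁻¹ʳ)) =
        - f.eval (c n) := by
      rw [mul_neg, mul_left_comm, Ring.mul_inverse_cancel _ (hf'c n), mul_one]
    rw [h3, neg_add_cancel_right]
    refine Ideal.mul_mem_left _ _ (Ideal.pow_le_pow_right (show n + 1 + 1 ≤ (n + 1) * 2 by omega) ?_)
    rw [pow_mul]
    exact Ideal.pow_mem_pow ((Ideal.neg_mem_iff _).2 <| Ideal.mul_mem_right _ _ ih) _
  have aux : ∀ m n, m ≤ n → c m ≡ c n [SMOD (I ^ m • ⊤ : Ideal R)] := by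
    intro m n hmn
    rw [← Ideal.one_eq_top, Ideal.smul_eq_mul, mul_one]
    obtain ⟨k, rfl⟩ := Nat.exists_eq_add_of_le hmn
    clear hmn
    induction k with
    | zero => rw [add_zero]
    | succ k ih => ?_
    rw [← add_assoc, hc, ← add_zero (c m), sub_eq_add_neg]
    refine ih.add ?_
    symm
    rw [SModEq.zero, Ideal.neg_mem_iff]
    refine Ideal.mul_mem_right _ _ (Ideal.pow_le_pow_right ?_ (hfcI _))
    rw [add_assoc]
    exact le_self_add
  obtain ⟨a, ha⟩ := IsPrecomplete.prec' c (aux _ _)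
  refine ⟨a, ?_, ?_⟩
  · suffices ∀ n, f.eval a ≡ 0 [SMOD (I ^ n • ⊤ : Ideal R)] by exact IsHausdorff.haus' _ this
    intro n
    specialize ha n
    rw [← Ideal.one_eq_top, Ideal.smul_eq_mul, mul_one] at ha ⊢
    refine (ha.symm.eval f).trans ?_
    rw [SModEq.zero]
    exact Ideal.pow_le_pow_right le_self_add (hfcI _)
  · specialize ha (0 + 1)
    rw [hc, pow_one, ← Ideal.one_eq_top, Ideal.smul_eq_mul, mul_one, sub_eq_add_neg] at ha
    rw [← SModEq.sub_mem, ← add_zero a₀]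
    refine ha.symm.trans (SModEq.rfl.add ?_)
    rw [SModEq.zero, Ideal.neg_mem_iff]
    exact Ideal.mul_mem_right _ _ h₁

open Polynomial in
/-- The Hensel lemma, Newton form, for a discrete valuation ring with uniformizer `π`. -/
theorem hensel_newton {O : Type*} [CommRing O] [IsDomain O] [IsDiscreteValuationRing O] (π : O)
    (hπ : Irreducible π) [IsAdicComplete (Ideal.span {π}) O] (g : O[X]) (a : O) (e : ℕ)
    (h1 : ¬ π ^ e ∣ g.derivative.eval a) (h2 : π ^ (2 * e) ∣ g.eval a) :
    ∃ b, g.eval b = 0 ∧ π ^ e ∣ b - a := by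
  have hne : g.derivative.eval a ≠ 0 := fun h => h1 (h ▸ dvd_zero _)
  obtain ⟨v, u, hu⟩ := IsDiscreteValuationRing.eq_unit_mul_pow_irreducible hne hπ
  have hv : v < e := by
    by_contra hle
    exact h1 (hu ▸ (pow_dvd_pow π (not_lt.mp hle)).mul_left _)
  obtain ⟨w, hw⟩ := h2
  obtain ⟨r, rfl⟩ := Nat.exists_eq_add_of_lt hv
  obtain ⟨q, hq⟩ := (g.map C).exists_mul_sq_add_linear_part_eq_eval_add (C a)
    (C (π ^ (v + r + 1)) * X)
  let h : O[X] := C (π ^ (r + 1) * w) + C (u : O) * X + q * C (π ^ (r + 1)) * X ^ 2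
  have hh : ∀ y, π ^ (v + (v + r + 1)) * h.eval y = g.eval (a + π ^ (v + r + 1) * y) := by
    intro y
    have := congrArg (eval y) hq
    simp only [derivative_map, eval_map, eval₂_at_apply, eval_add, eval_mul, eval_pow, eval_C,
      eval_X] at this
    have h4 : eval y (eval₂ C (C a + C (π ^ (v + r + 1)) * X) g) =
        g.eval (a + π ^ (v + r + 1) * y) := by
      rw [← Polynomial.comp, eval_comp]
      simp
    rw [h4] at this
    rw [← this, hw, hu]
    simp only [h, eval_add, eval_mul, eval_pow, eval_C, eval_X]
    ring
  obtain ⟨y, hy, -⟩ := hensel_unit (Ideal.span {π}) h 0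
    (by
      rw [Ideal.mem_span_singleton]
      simp only [h, eval_add, eval_mul, eval_pow, eval_C, eval_X]
      exact ⟨π ^ r * w, by ring⟩)
    (by
      have : h.derivative.eval 0 = (u : O) := by
        simp only [h, derivative_add, derivative_mul, derivative_C, derivative_X,
          derivative_X_pow]
        simp
      rw [this]; exact u.isUnit)
  refine ⟨a + π ^ (v + r + 1) * y, ?_, ?_⟩
  · rw [← hh, hy, mul_zero]
  · simp
open Polynomial in
theorem exists_presentation {S F : Type*} [CommRing S] [IsDomain S] [IsIntegrallyClosed S]
    [CharZero S] [Field F] [Algebra S F] [FaithfulSMul S F] {n : ℕ} (x : Fin n → F)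
    (hx : ∀ i, IsAlgebraic S (x i)) (P : F → Prop)
    (hP : ∀ z, ∃ c : S, c ≠ 0 ∧ P (c • z)) :
    ∃ (θ : F) (G : S[X]) (b : S) (A : Fin n → S[X]), P θ ∧ b ≠ 0 ∧
      aeval θ G = 0 ∧ aeval θ (derivative G) ≠ 0 ∧ (∀ i, aeval θ (A i) = b • x i) ∧
      ∀ Q : S[X], aeval θ Q = 0 → G ∣ Q := by
  classical
  have hinj : Function.Injective (algebraMap S F) := FaithfulSMul.algebraMap_injective S F
  let : Algebra (FractionRing S) F := FractionRing.liftAlgebra S F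
  have : IsScalarTower S (FractionRing S) F := FractionRing.isScalarTower_liftAlgebra S F
  have : CharZero (FractionRing S) :=
    charZero_of_injective_algebraMap (IsFractionRing.injective S (FractionRing S))
  have hxint : ∀ i, IsIntegral (FractionRing S) (x i) := fun i =>
    ((hx i).extendScalars (IsFractionRing.injective S (FractionRing S))).isIntegral
  let E := IntermediateField.adjoin (FractionRing S) (Set.range x)
  have : FiniteDimensional (FractionRing S) E := by
    apply IntermediateField.finiteDimensional_adjoin
    rintro _ ⟨i, rfl⟩
    exact hxint i
  obtain ⟨α, hα⟩ := Field.exists_primitive_element (FractionRing S) E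
  have hαF : IsIntegral (FractionRing S) (α : F) :=
    (Algebra.IsIntegral.isIntegral (R := FractionRing S) α).map E.val
  have hq : ∀ i, ∃ q : (FractionRing S)[X], aeval (α : F) q = x i := by
    intro i
    have hm : (⟨x i, IntermediateField.subset_adjoin _ _ ⟨i, rfl⟩⟩ : E) ∈
        IntermediateField.adjoin (FractionRing S) {α} := by
      rw [hα]; trivial
    rw [← IntermediateField.mem_toSubalgebra,
      IntermediateField.adjoin_simple_toSubalgebra_of_isAlgebraic
        (Algebra.IsAlgebraic.isAlgebraic α), Algebra.adjoin_singleton_eq_range_aeval] at hm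
    obtain ⟨q, hq⟩ := hm
    refine ⟨q, ?_⟩
    have := congrArg E.val hq
    simpa [← Polynomial.aeval_algHom_apply] using this
  choose q hq using hq
  have hαS : IsAlgebraic S (α : F) :=
    (IsFractionRing.isAlgebraic_iff S (FractionRing S) F).mpr hαF.isAlgebraic
  obtain ⟨y, hy0, hyint⟩ := hαS.exists_integral_multiple
  obtain ⟨c, hc0, hcP⟩ := hP (y • (α : F))
  have hcy : c * y ≠ 0 := mul_ne_zero hc0 hy0
  have hθ : IsIntegral S (c • y • (α : F)) := hyint.smul c
  have hcyF : algebraMap S F (c * y) ≠ 0 := (map_ne_zero_iff _ hinj).mpr hcy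
  -- express `x i` through `θ`
  have hq2 : ∀ i, ∃ (b : S) (A : S[X]), b ≠ 0 ∧ aeval (c • y • (α : F)) A = b • x i := by
    intro i
    let q' : (FractionRing S)[X] := (q i).comp (C (algebraMap S _ (c * y))⁻¹ * X)
    have hq' : aeval (c • y • (α : F)) q' = x i := by
      rw [← hq i]
      simp only [q', aeval_comp]
      congr 2
      rw [map_mul, aeval_C, aeval_X, map_inv₀, smul_smul,
        ← IsScalarTower.algebraMap_apply, Algebra.smul_def, inv_mul_cancel_left₀ hcyF]
    obtain ⟨b, hb, hbq⟩ := IsLocalization.integerNormalization_spec (nonZeroDivisors S) q'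
    refine ⟨b, IsLocalization.integerNormalization (nonZeroDivisors S) q',
      nonZeroDivisors.ne_zero hb, ?_⟩
    have := congrArg (aeval (c • y • (α : F))) hbq
    rw [aeval_map_algebraMap, AlgHom.map_smul_of_tower, hq'] at this
    exact this
  choose b A hb hA using hq2
  refine ⟨c • y • (α : F), minpoly S (c • y • (α : F)), ∏ i, b i,
    fun i => C (∏ j ∈ Finset.univ.erase i, b j) * A i, hcP,
    Finset.prod_ne_zero_iff.mpr fun i _ => hb i, minpoly.aeval _ _, ?_, ?_, ?_⟩
  · intro h
    have hdvd := minpoly.isIntegrallyClosed_dvd hθ h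
    have hpos := minpoly.natDegree_pos hθ
    have hne : derivative (minpoly S (c • y • (α : F))) ≠ 0 := by
      intro h0
      have := derivative_eq_zero.mp h0
      omega
    have h1 := Polynomial.degree_le_of_dvd hdvd hne
    have h2 := Polynomial.degree_derivative_lt (minpoly.ne_zero hθ)
    exact absurd h1 (not_le.mpr h2)
  · intro i
    rw [map_mul, aeval_C, hA, ← Finset.prod_erase_mul _ _ (Finset.mem_univ i), mul_smul,
      Algebra.smul_def (∏ j ∈ Finset.univ.erase i, b j)]
  · exact fun Q hQ => minpoly.isIntegrallyClosed_dvd hθ hQ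

/-- Homogeneous polynomials scale. -/
theorem aeval_mul_of_isHomogeneous {R A : Type*} [CommRing R] [CommRing A] [Algebra R A]
    {σ : Type*} {f : MvPolynomial σ R} {d : ℕ} (hf : f.IsHomogeneous d) (c : A) (x : σ → A) :
    MvPolynomial.aeval (fun i => c * x i) f = c ^ d * MvPolynomial.aeval x f := by
  classical
  rw [MvPolynomial.aeval_def, MvPolynomial.aeval_def, MvPolynomial.eval₂_eq,
    MvPolynomial.eval₂_eq, Finset.mul_sum]
  refine Finset.sum_congr rfl fun m hm => ?_
  have hd : ∑ i ∈ m.support, m i = d := by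
    have := hf (MvPolynomial.mem_support_iff.mp hm)
    rw [← this, Finsupp.weight_apply]
    simp [Finsupp.sum]
  simp_rw [mul_pow]
  rw [Finset.prod_mul_distrib, Finset.prod_pow_eq_pow_sum, hd]
  ring

open Filter in
/-- Sequences that are infinitely `π`-divisible along a nonprincipal ultrafilter. -/
noncomputable def ultraIdeal {O : Type*} [CommRing O] (π : O) : Ideal (ℕ → O) where
  carrier := {a | ∀ j : ℕ, ∀ᶠ m in (hyperfilter ℕ : Filter ℕ), π ^ j ∣ a m}
  zero_mem' := fun j => Eventually.of_forall fun m => dvd_zero _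
  add_mem' := fun {a b} ha hb j => by
    filter_upwards [ha j, hb j] with m h1 h2 using dvd_add h1 h2
  smul_mem' := fun c a ha j => by
    filter_upwards [ha j] with m h1 using h1.mul_left _

open Filter in
theorem mem_ultraIdeal {O : Type*} [CommRing O] (π : O) (a : ℕ → O) :
    a ∈ ultraIdeal π ↔ ∀ j : ℕ, ∀ᶠ m in (hyperfilter ℕ : Filter ℕ), π ^ j ∣ a m := Iff.rfl

open Filter in
theorem notMem_ultraIdeal {O : Type*} [CommRing O] (π : O) (a : ℕ → O) (h : a ∉ ultraIdeal π) :
    ∃ j : ℕ, ∀ᶠ m in (hyperfilter ℕ : Filter ℕ), ¬ π ^ j ∣ a m := by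
  rw [mem_ultraIdeal] at h
  push Not at h
  obtain ⟨j, hj⟩ := h
  exact ⟨j, by rw [Ultrafilter.eventually_not]; simpa using hj⟩

section
variable {O : Type*} [CommRing O] [IsDomain O] [IsDiscreteValuationRing O] {π : O}

open Filter in
/-- Any element outside the ideal divides a power of `π`, modulo the ideal. -/
theorem exists_mul_sub_mem (hπ : Irreducible π) (b : ℕ → O) (hb : b ∉ ultraIdeal π) :
    ∃ (e : ℕ) (c : ℕ → O), b * c - (fun _ => π ^ e) ∈ ultraIdeal π := by
  classical
  obtain ⟨e, he⟩ := notMem_ultraIdeal π b hb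
  have hdvd : ∀ m, ¬ π ^ e ∣ b m → ∃ c, b m * c = π ^ e := by
    intro m hm
    have hne : b m ≠ 0 := fun h => hm (h ▸ dvd_zero _)
    obtain ⟨v, u, hu⟩ := IsDiscreteValuationRing.eq_unit_mul_pow_irreducible hne hπ
    have hv : v ≤ e := by
      by_contra hle
      exact hm (hu ▸ (pow_dvd_pow π (not_le.mp hle).le).mul_left _)
    refine ⟨(↑u⁻¹ : O) * π ^ (e - v), ?_⟩
    rw [hu]
    calc (u : O) * π ^ v * ((↑u⁻¹ : O) * π ^ (e - v))
        = ((u : O) * (↑u⁻¹ : O)) * (π ^ v * π ^ (e - v)) := by ring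
      _ = π ^ e := by rw [Units.mul_inv, one_mul, ← pow_add, Nat.add_sub_cancel' hv]
  refine ⟨e, fun m => if h : π ^ e ∣ b m then 0 else (hdvd m h).choose, fun j => ?_⟩
  filter_upwards [he] with m hm
  have := (hdvd m hm).choose_spec
  simp [hm, this]

open Filter in
theorem const_notMem (hπ : Irreducible π) (a : O) (ha : a ≠ 0) :
    (fun _ => a : ℕ → O) ∉ ultraIdeal π := by
  intro h
  obtain ⟨v, u, hu⟩ := IsDiscreteValuationRing.eq_unit_mul_pow_irreducible ha hπ
  obtain ⟨m, hm⟩ := (h (v + 1)).exists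
  rw [hu] at hm
  have : π ^ (v + 1) ∣ π ^ v := by
    rwa [mul_comm, u.isUnit.dvd_mul_right] at hm
  rw [pow_dvd_pow_iff hπ.ne_zero hπ.not_isUnit] at this
  omega

theorem ultraIdeal_isPrime (hπ : Irreducible π) : (ultraIdeal π).IsPrime := by
  constructor
  · intro h
    exact const_notMem hπ 1 one_ne_zero (h ▸ Submodule.mem_top)
  · intro a b hab
    by_contra hcon
    push Not at hcon
    obtain ⟨e, c, hc⟩ := exists_mul_sub_mem hπ a hcon.1
    obtain ⟨e', c', hc'⟩ := exists_mul_sub_mem hπ b hcon.2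
    refine const_notMem hπ (π ^ (e + e')) (pow_ne_zero _ hπ.ne_zero) ?_
    have h1 : a * c * (b * c') ∈ ultraIdeal π := by
      have := (ultraIdeal π).mul_mem_right (c * c') hab
      convert this using 1; ring
    have h2 := (ultraIdeal π).mul_mem_right (b * c') hc
    have h3 := (ultraIdeal π).mul_mem_left (fun _ => π ^ e) hc'
    have h4 := (ultraIdeal π).sub_mem h1 ((ultraIdeal π).add_mem h2 h3)
    convert h4 using 1
    funext m
    simp only [Pi.sub_apply, Pi.mul_apply, Pi.add_apply]
    ring
end

open Filter in
/-- Main part of the proof of `greenberg`. -/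
theorem greenberg_aux {O : Type*} [CommRing O] [IsDomain O] [IsDiscreteValuationRing O] [CharZero O]
    (π : O) (hπ : Irreducible π) [IsAdicComplete (Ideal.span {π}) O] {n d : ℕ}
    (f : MvPolynomial (Fin n) O) (hf : f.IsHomogeneous d)
    (y : ℕ → Fin n → O) (hy : ∀ m, ∃ i, ¬ π ∣ y m i)
    (hfy : ∀ m, π ^ m ∣ MvPolynomial.eval (y m) f)
    {F : Type*} [Field F] [Algebra O F] (ρ : (ℕ → O) →+* F)
    (hρ : ∀ a, ρ a = 0 ↔ a ∈ ultraIdeal π) (hOF : ∀ a : O, algebraMap O F a = ρ (fun _ => a))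
    (hdiv : ∀ z : F, ∃ a b, ρ b ≠ 0 ∧ z = ρ a / ρ b) :
    ∃ y : Fin n → O, y ≠ 0 ∧ MvPolynomial.eval y f = 0 := by
  classical
  have hinj : Function.Injective (algebraMap O F) := by
    rw [injective_iff_map_eq_zero]
    intro a ha
    by_contra hne
    rw [hOF, hρ] at ha
    exact const_notMem hπ a hne ha
  have : FaithfulSMul O F := (faithfulSMul_iff_algebraMap_injective O F).mpr hinj
  let x : Fin n → F := fun i => ρ (fun m => y m i)
  -- `x` is a nontrivial zero
  have hx0 : ∃ i, x i ≠ 0 := by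
    by_contra hcon
    push Not at hcon
    have h1 : ∀ i, ∀ᶠ m in (hyperfilter ℕ : Filter ℕ), π ^ 1 ∣ y m i := fun i =>
      (hρ _).mp (hcon i) 1
    obtain ⟨m, hm⟩ := (eventually_all.mpr h1).exists
    obtain ⟨i, hi⟩ := hy m
    exact hi (by simpa using hm i)
  have hfx : MvPolynomial.aeval x f = 0 := by
    have h1 : (MvPolynomial.aeval x : MvPolynomial (Fin n) O →ₐ[O] F).toRingHom =
        ρ.comp (RingHom.pi fun m => MvPolynomial.eval (y m)) := by
      refine MvPolynomial.ringHom_ext ?_ ?_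
      · intro a
        refine (MvPolynomial.aeval_C _ _).trans ?_
        rw [hOF]
        change ρ _ = ρ _
        congr 1; funext m; simp
      · intro i
        refine (MvPolynomial.aeval_X _ _).trans ?_
        change ρ _ = ρ _
        congr 1; funext m; simp
    have h2 := congrArg (fun g : MvPolynomial (Fin n) O →+* F => g f) h1
    refine h2.trans ((hρ _).mpr fun j => ?_)
    have h3 : ∀ᶠ m in (hyperfilter ℕ : Filter ℕ), j ≤ m :=
      Nat.hyperfilter_le_atTop (eventually_ge_atTop j)
    filter_upwards [h3] with m hm
    exact (pow_dvd_pow π hm).trans (hfy m)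
  -- transcendence basis among the coordinates
  obtain ⟨s, hs⟩ : ∃ s : Set (Fin n), Maximal (fun s => AlgebraicIndepOn O x s) s := by
    refine (Set.toFinite {s : Set (Fin n) | AlgebraicIndepOn O x s}).exists_maximal ⟨∅, ?_⟩
    exact (algebraicIndependent_empty_type_iff).mpr hinj
  have hind : AlgebraicIndependent O (fun i : s => x i) := hs.prop
  have halg : ∀ i, IsAlgebraic (Algebra.adjoin O (Set.range fun i : s => x i)) (x i) := by
    intro i
    by_contra htr
    have himg : (Set.range fun i : s => x i) = x '' s := by
      rw [Set.image_eq_range]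
    rw [himg] at htr
    have h1 : AlgebraicIndepOn O x (insert i s) := AlgebraicIndepOn.insert hs.prop htr
    have h2 : i ∈ s := hs.le_of_ge h1 (Set.subset_insert i s) (Set.mem_insert i s)
    exact htr (isAlgebraic_algebraMap
      (⟨_, Algebra.subset_adjoin ⟨i, h2, rfl⟩⟩ : Algebra.adjoin O (x '' s)))
  let S := MvPolynomial s O
  let φ : S →ₐ[O] F := MvPolynomial.aeval (fun i : s => x i)
  let : Algebra S F := φ.toRingHom.toAlgebra
  have hSF : ∀ a : S, algebraMap S F a = φ a := fun _ => rfl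
  have hφ : Function.Injective φ := hind
  have : FaithfulSMul S F := (faithfulSMul_iff_algebraMap_injective S F).mpr hφ
  have halgS : ∀ i, IsAlgebraic S (x i) := by
    intro i
    refine IsAlgebraic.of_ringHom_of_comp_eq (S := Algebra.adjoin O (Set.range fun i : s => x i))
      hind.aevalEquiv.toRingEquiv (RingHom.id F) (halg i) hind.aevalEquiv.surjective
      Function.injective_id ?_
    ext a
    · rfl
    · rfl
  have hP : ∀ z : F, ∃ c : S, c ≠ 0 ∧ ∃ a, ρ a = c • z := by
    intro z
    obtain ⟨a, b, hb0, rfl⟩ := hdiv z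
    have hb : b ∉ ultraIdeal π := fun h => hb0 ((hρ b).mpr h)
    obtain ⟨e, c, hc⟩ := exists_mul_sub_mem hπ b hb
    have hc' : ρ b * ρ c = ρ (fun _ => π ^ e) := by
      rw [← map_mul, ← sub_eq_zero, ← map_sub, hρ]; exact hc
    refine ⟨MvPolynomial.C (π ^ e), ?_, a * c, ?_⟩
    · rw [Ne, MvPolynomial.C_eq_zero]; exact pow_ne_zero _ hπ.ne_zero
    · rw [Algebra.smul_def, hSF]
      have h1 : φ (MvPolynomial.C (π ^ e)) = ρ (fun _ => π ^ e) := by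
        rw [← hOF]; exact MvPolynomial.aeval_C _ _
      rw [h1, ← hc', map_mul]
      change ρ a * ρ c = ρ b * ρ c * (ρ a / ρ b)
      field_simp
  obtain ⟨θ, G, b, A, ⟨ϑ, hϑ⟩, hb, hG, hG', hA, hdvd⟩ :=
    exists_presentation (S := S) (F := F) x halgS (fun z => ∃ a, ρ a = z) hP
  -- evaluation at points
  let ev : (s → O) → O → Polynomial S →+* O := fun τ t =>
    Polynomial.eval₂RingHom (MvPolynomial.eval τ) t
  have hev : ∀ Q : Polynomial S, Polynomial.aeval θ Q =
      ρ (fun m => ev (fun i => y m i) (ϑ m) Q) := by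
    intro Q
    have h1 : (Polynomial.aeval θ : Polynomial S →ₐ[S] F).toRingHom =
        ρ.comp (RingHom.pi fun m => ev (fun i => y m i) (ϑ m)) := by
      refine Polynomial.ringHom_ext' (MvPolynomial.ringHom_ext ?_ ?_) ?_
      · intro a
        simp only [AlgHom.toRingHom_eq_coe, RingHom.coe_comp, RingHom.coe_coe,
          Function.comp_apply, Polynomial.aeval_C, hSF]
        refine (MvPolynomial.aeval_C _ _).trans ?_
        rw [hOF]
        congr 1; funext m; simp [ev]; exact (MvPolynomial.eval_C _).symm
      · intro i
        simp only [AlgHom.toRingHom_eq_coe, RingHom.coe_comp, RingHom.coe_coe,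
          Function.comp_apply, Polynomial.aeval_C, hSF]
        refine (MvPolynomial.aeval_X _ _).trans ?_
        change ρ _ = ρ _
        congr 1; funext m; simp [ev]; exact (MvPolynomial.eval_X (f := fun i : s => y m i) i).symm
      · simp only [AlgHom.toRingHom_eq_coe, RingHom.coe_coe,
          Polynomial.aeval_X, ← hϑ]
        change ρ _ = ρ _
        congr 1; funext m; simp [ev]
    exact congrArg (fun g : Polynomial S →+* F => g Q) h1
  obtain ⟨i₀, hi₀⟩ := hx0
  have hA0 : Polynomial.aeval θ (A i₀) ≠ 0 := by
    rw [hA, Algebra.smul_def]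
    exact mul_ne_zero ((map_ne_zero_iff _ hφ).mpr hb) hi₀
  rw [hev, Ne, hρ] at hG' hA0
  rw [hev, hρ] at hG
  obtain ⟨e₁, he₁⟩ := notMem_ultraIdeal π _ hG'
  obtain ⟨e₂, he₂⟩ := notMem_ultraIdeal π _ hA0
  obtain ⟨m, hm0, hm1, hm2⟩ := ((hG (2 * (e₁ + e₂))).and (he₁.and he₂)).exists
  let τ : s → O := fun i => y m i
  have hevm : ∀ t Q, ev τ t Q = (Q.map (MvPolynomial.eval τ)).eval t := by
    intro t Q
    rw [Polynomial.eval_map]; rfl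
  obtain ⟨t, ht0, ht⟩ := hensel_newton π hπ (G.map (MvPolynomial.eval τ)) (ϑ m) (e₁ + e₂)
    (by
      rw [Polynomial.derivative_map, ← hevm]
      exact fun h => hm1 ((pow_dvd_pow π (Nat.le_add_right _ _)).trans h))
    (by rw [← hevm]; exact hm0)
  refine ⟨fun i => ev τ t (A i), ?_, ?_⟩
  · intro h0
    have h1 : ev τ t (A i₀) = 0 := congrFun h0 i₀
    apply hm2
    have h2 := Polynomial.sub_dvd_eval_sub t (ϑ m) ((A i₀).map (MvPolynomial.eval τ))
    rw [← hevm, ← hevm, h1, zero_sub, dvd_neg] at h2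
    exact ((pow_dvd_pow π (Nat.le_add_left _ _)).trans ht).trans h2
  · have h1 : MvPolynomial.eval (fun i => ev τ t (A i)) f =
        ev τ t (MvPolynomial.aeval A f) := by
      have h2 : MvPolynomial.eval (fun i => ev τ t (A i)) =
          (ev τ t).comp (MvPolynomial.aeval A : MvPolynomial (Fin n) O →ₐ[O] _).toRingHom := by
        refine MvPolynomial.ringHom_ext ?_ ?_
        · intro a
          simp [ev, Polynomial.algebraMap_apply]
          exact (MvPolynomial.eval_C _).symm
        · intro i
          simp
      exact congrArg (fun g : MvPolynomial (Fin n) O →+* O => g f) h2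
    have h3 : Polynomial.aeval θ (MvPolynomial.aeval A f) = 0 := by
      have h4 : Polynomial.aeval θ (MvPolynomial.aeval A f) =
          MvPolynomial.aeval (fun i => φ b * x i) f := by
        have h5 : ((Polynomial.aeval θ : Polynomial S →ₐ[S] F).toRingHom).comp
            (MvPolynomial.aeval A : MvPolynomial (Fin n) O →ₐ[O] _).toRingHom =
            (MvPolynomial.aeval (fun i => φ b * x i) :
              MvPolynomial (Fin n) O →ₐ[O] F).toRingHom := by
          refine MvPolynomial.ringHom_ext ?_ ?_
          · intro a
            simp [Polynomial.algebraMap_apply, hSF, φ]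
          · intro i
            simp [hA, Algebra.smul_def, hSF]
        exact congrArg (fun g : MvPolynomial (Fin n) O →+* F => g f) h5
      rw [h4, aeval_mul_of_isHomogeneous hf, hfx, mul_zero]
    obtain ⟨Q, hQ⟩ := hdvd _ h3
    rw [h1, hQ, map_mul, hevm t G, ht0, zero_mul]

/-- Solvability modulo all powers of `π` implies solvability (Greenberg), for a complete
discrete valuation ring of characteristic zero. -/
theorem greenberg {O : Type*} [CommRing O] [IsDomain O] [IsDiscreteValuationRing O] [CharZero O]
    (π : O) (hπ : Irreducible π) [IsAdicComplete (Ideal.span {π}) O] {n d : ℕ}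
    (f : MvPolynomial (Fin n) O) (hf : f.IsHomogeneous d)
    (H : ∀ m : ℕ, ∃ y : Fin n → O, (∃ i, ¬ π ∣ y i) ∧ π ^ m ∣ MvPolynomial.eval y f) :
    ∃ y : Fin n → O, y ≠ 0 ∧ MvPolynomial.eval y f = 0 := by
  choose y hy hfy using H
  have hprime := ultraIdeal_isPrime hπ
  have hDF : Function.Injective (algebraMap ((ℕ → O) ⧸ ultraIdeal π)
    (FractionRing ((ℕ → O) ⧸ ultraIdeal π))) := IsFractionRing.injective _ _
  have hρ : ∀ a, ((algebraMap ((ℕ → O) ⧸ ultraIdeal π)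
      (FractionRing ((ℕ → O) ⧸ ultraIdeal π))).comp (Ideal.Quotient.mk (ultraIdeal π))) a = 0 ↔
      a ∈ ultraIdeal π := by
    intro a
    rw [← Ideal.Quotient.eq_zero_iff_mem]
    exact map_eq_zero_iff _ hDF
  refine greenberg_aux π hπ f hf y hy hfy ((algebraMap ((ℕ → O) ⧸ ultraIdeal π)
    (FractionRing ((ℕ → O) ⧸ ultraIdeal π))).comp (Ideal.Quotient.mk (ultraIdeal π))) hρ
    (fun a => rfl) ?_
  intro z
  obtain ⟨u, v, hv, rfl⟩ := IsFractionRing.div_surjective (A := (ℕ → O) ⧸ ultraIdeal π) z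
  obtain ⟨a, rfl⟩ := Ideal.Quotient.mk_surjective u
  obtain ⟨b, rfl⟩ := Ideal.Quotient.mk_surjective v
  refine ⟨a, b, ?_, rfl⟩
  rw [Ne, hρ]
  intro hb
  exact nonZeroDivisors.ne_zero hv (Ideal.Quotient.eq_zero_iff_mem.mpr hb)

/-- Extract the maximal power of `π` dividing a vector. -/
theorem exists_primitive {O : Type*} [CommRing O] (π : O) {n : ℕ} (e : ℕ) (x : Fin n → O)
    (hx : ∃ i, ¬ π ^ e ∣ x i) :
    ∃ j < e, ∃ y : Fin n → O, (∀ i, x i = π ^ j * y i) ∧ ∃ i, ¬ π ∣ y i := by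
  induction e generalizing x with
  | zero =>
    obtain ⟨i, hi⟩ := hx
    exact absurd (by simp) hi
  | succ e ih =>
    by_cases h : ∃ i, ¬ π ∣ x i
    · exact ⟨0, Nat.succ_pos e, x, fun i => by simp, h⟩
    · push Not at h
      choose z hz using h
      obtain ⟨i, hi⟩ := hx
      obtain ⟨j, hj, y, hy, hy'⟩ := ih z ⟨i, fun h => hi (by
        rw [hz i, pow_succ']; exact mul_dvd_mul_left π h)⟩
      exact ⟨j + 1, by omega, y, fun i => by rw [hz i, hy i, pow_succ']; ring, hy'⟩

/-- Primitive solutions modulo every power of `p`. -/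
theorem exists_primitive_approx (p : ℕ) [Fact p.Prime] {k : Type*} [Field k] [CharP k p]
    [IsAlgClosed k] {d n : ℕ} (hd : 0 < d) (hn : d < n) (f : MvPolynomial (Fin n) (WittVector p k))
    (hf : f.IsHomogeneous d) (e : ℕ) (he : 0 < e) :
    ∃ y : Fin n → WittVector p k, (∃ i, ¬ (p : WittVector p k) ∣ y i) ∧
      (p : WittVector p k) ^ e ∣ MvPolynomial.eval y f := by
  classical
  let ξ : Fin n → WittVector p (MvPolynomial (Fin n × Fin e) k) := fun i =>
    WittVector.mk p (fun l => if h : l < e then MvPolynomial.X (i, ⟨l, h⟩) else 0)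
  let X : (Fin n × Fin e → k) → Fin n → WittVector p k := fun a i =>
    WittVector.mk p (fun l => if h : l < e then a (i, ⟨l, h⟩) else 0)
  let Φ := MvPolynomial.eval₂ (WittVector.map (p := p) (MvPolynomial.C : k →+* MvPolynomial (Fin n × Fin e) k)) ξ f
  have hX : ∀ a i, WittVector.map (MvPolynomial.eval a) (ξ i) = X a i := by
    intro a i
    ext l
    rw [WittVector.map_coeff]
    simp only [ξ, X, WittVector.coeff_mk]
    split_ifs <;> simp
  have hΦ : ∀ a, WittVector.map (MvPolynomial.eval a) Φ = MvPolynomial.eval (X a) f := by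
    intro a
    simp only [Φ]
    rw [MvPolynomial.hom_eval₂]
    have h1 : (WittVector.map (p := p) (MvPolynomial.eval a)).comp
        (WittVector.map (MvPolynomial.C : k →+* MvPolynomial (Fin n × Fin e) k)) =
        RingHom.id _ := by
      ext z l
      simp [WittVector.map_coeff]
    have h2 : (fun i => WittVector.map (p := p) (MvPolynomial.eval a) (ξ i)) = X a := funext (hX a)
    rw [h1, h2]
    rfl
  have hcoeff : ∀ a j, MvPolynomial.eval a (Φ.coeff j) = (MvPolynomial.eval (X a) f).coeff j := by
    intro a j
    rw [← hΦ, WittVector.map_coeff]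
  have hscale : ∀ (c : WittVector p k) (y : Fin n → WittVector p k),
      MvPolynomial.eval (fun i => c * y i) f = c ^ d * MvPolynomial.eval y f := by
    intro c y
    have := aeval_mul_of_isHomogeneous hf c y
    simpa [MvPolynomial.aeval_eq_eval] using this
  have hX0 : MvPolynomial.eval (X 0) f = 0 := by
    have h1 : X 0 = fun i => (0 : WittVector p k) * (0 : WittVector p k) := by
      funext i
      ext l
      simp [X]
    rw [h1, hscale 0 (fun _ => 0), zero_pow hd.ne', zero_mul]
  obtain ⟨a, ha0, ha⟩ := exists_nontrivial_zero (m := (d + 1) * e - 1)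
    (fun j => Φ.coeff j) (fun j => by rw [hcoeff, hX0, WittVector.zero_coeff]) (by
      rw [Nat.card_eq_fintype_card, Fintype.card_prod, Fintype.card_fin, Fintype.card_fin]
      have : (d + 1) * e ≤ n * e := Nat.mul_le_mul_right e hn
      have : 0 < (d + 1) * e := by positivity
      omega)
  have hdiv : (p : WittVector p k) ^ ((d + 1) * e - 1) ∣ MvPolynomial.eval (X a) f := by
    rw [← Ideal.mem_span_singleton, WittVector.mem_span_p_pow_iff_le_coeff_eq_zero]
    intro j hj
    rw [← hcoeff]
    exact ha ⟨j, hj⟩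
  obtain ⟨⟨i₀, l₀⟩, hi₀⟩ := Function.ne_iff.mp ha0
  obtain ⟨j, hj, y, hy, hprim⟩ := exists_primitive (p : WittVector p k) e (X a) ⟨i₀, fun h => by
    rw [← Ideal.mem_span_singleton, WittVector.mem_span_p_pow_iff_le_coeff_eq_zero] at h
    have := h l₀ l₀.2
    simp [X] at this
    exact hi₀ this⟩
  refine ⟨y, hprim, ?_⟩
  have hXy : X a = fun i => (p : WittVector p k) ^ j * y i := funext hy
  rw [hXy, hscale, ← pow_mul] at hdiv
  have hp : (p : WittVector p k) ≠ 0 := (WittVector.irreducible p).ne_zero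
  have hle : j * d + e ≤ (d + 1) * e - 1 := by
    obtain ⟨e', rfl⟩ : ∃ e', e = e' + 1 := ⟨e - 1, by omega⟩
    have h1 : j * d ≤ e' * d := Nat.mul_le_mul_right d (by omega)
    have h2 : (d + 1) * (e' + 1) = e' * d + d + (e' + 1) := by ring
    omega
  have h3 := (pow_dvd_pow (p : WittVector p k) hle).trans hdiv
  rw [pow_add] at h3
  exact (mul_dvd_mul_iff_left (pow_ne_zero _ hp)).mp h3

/-- The ring of Witt vectors of a perfect field has characteristic zero. -/
theorem charZero_wittVector (p : ℕ) [Fact p.Prime] {k : Type*} [Field k] [CharP k p]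
    [IsAlgClosed k] : CharZero (WittVector p k) := by
  refine charZero_of_inj_zero fun N hN => ?_
  by_contra hne
  obtain ⟨v, u, hu, rfl⟩ := Nat.exists_eq_pow_mul_and_not_dvd hne p (Fact.out : p.Prime).ne_one
  have hp : (p : WittVector p k) ≠ 0 := (WittVector.irreducible p).ne_zero
  push_cast at hN
  rcases mul_eq_zero.mp hN with h | h
  · exact pow_ne_zero _ hp h
  · apply hu
    rw [← CharP.cast_eq_zero_iff k p u]
    have := congrArg WittVector.constantCoeff h
    simpa using this

/-- Clearing denominators. -/
theorem exists_integral_multiple {R K : Type*} [CommRing R] [IsDomain R] [Field K] [Algebra R K]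
    [IsFractionRing R K] {σ : Type*} (f : MvPolynomial σ K) {d : ℕ} (hf : f.IsHomogeneous d) :
    ∃ (c : R) (g : MvPolynomial σ R), c ≠ 0 ∧ g.IsHomogeneous d ∧
      MvPolynomial.map (algebraMap R K) g = MvPolynomial.C (algebraMap R K c) * f := by
  classical
  obtain ⟨b, hb⟩ := IsLocalization.exist_integer_multiples (nonZeroDivisors R) f.support
    (fun m => f.coeff m)
  choose! g hg using hb
  refine ⟨b, ∑ m ∈ f.support, MvPolynomial.monomial m (g m), nonZeroDivisors.ne_zero b.2,
    ?_, ?_⟩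
  · refine MvPolynomial.IsHomogeneous.sum _ _ _ fun m hm => ?_
    refine MvPolynomial.isHomogeneous_monomial _ ?_
    have := hf (MvPolynomial.mem_support_iff.mp hm)
    rw [← this, Finsupp.degree_eq_weight_one]
    rfl
  · rw [map_sum]
    conv_rhs => rw [f.as_sum, Finset.mul_sum]
    refine Finset.sum_congr rfl fun m hm => ?_
    rw [MvPolynomial.map_monomial, MvPolynomial.C_mul_monomial, hg m hm, Algebra.smul_def]

/-- Zeros of an integral multiple give zeros of the original polynomial. -/
theorem eval_eq_zero_of_multiple {R K : Type*} [CommRing R] [IsDomain R] [Field K] [Algebra R K]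
    [IsFractionRing R K] {σ : Type*} (f : MvPolynomial σ K) (c : R) (g : MvPolynomial σ R)
    (hc : c ≠ 0)
    (hgf : MvPolynomial.map (algebraMap R K) g = MvPolynomial.C (algebraMap R K c) * f)
    (y : σ → R) (hy0 : y ≠ 0) (hy : MvPolynomial.eval y g = 0) :
    ∃ x : σ → K, x ≠ 0 ∧ MvPolynomial.eval x f = 0 := by
  have hinj : Function.Injective (algebraMap R K) := IsFractionRing.injective _ _
  refine ⟨fun i => algebraMap R K (y i), ?_, ?_⟩
  · intro h
    apply hy0
    funext i
    exact (map_eq_zero_iff _ hinj).mp (congrFun h i)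
  · have h1 := congrArg (MvPolynomial.eval (fun i => algebraMap R K (y i))) hgf
    have h2 : MvPolynomial.eval (fun i => algebraMap R K (y i))
        (MvPolynomial.map (algebraMap R K) g) = algebraMap R K (MvPolynomial.eval y g) := by
      rw [MvPolynomial.eval_map, MvPolynomial.eval₂_eq, MvPolynomial.eval_eq, map_sum]
      simp only [map_mul, map_prod, map_pow]
    rw [h2, hy, map_zero, map_mul, MvPolynomial.eval_C] at h1
    exact (mul_eq_zero.mp h1.symm).resolve_left ((map_ne_zero_iff _ hinj).mpr hc)

end LangC1


/-- **Lang's theorem**: for every prime `p`, the fraction field of the ring of `p`-typical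
Witt vectors over an algebraic closure of `𝔽_p` is `C₁`: every homogeneous polynomial of
degree `d > 0` in `n > d` variables has a nontrivial zero. -/
theorem wittVector_fractionField_C1 (p : ℕ) [Fact p.Prime] (d n : ℕ) (hd : 0 < d)
    (hn : d < n)
    (f : MvPolynomial (Fin n) (FractionRing (WittVector p (AlgebraicClosure (ZMod p)))))
    (hf : f.IsHomogeneous d) :
    ∃ x : Fin n → FractionRing (WittVector p (AlgebraicClosure (ZMod p))),
      x ≠ 0 ∧ MvPolynomial.eval x f = 0 := by
  have hchar := LangC1.charZero_wittVector p (k := AlgebraicClosure (ZMod p))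
  obtain ⟨c, g, hc, hg, hgf⟩ := LangC1.exists_integral_multiple
    (R := WittVector p (AlgebraicClosure (ZMod p))) f hf
  obtain ⟨y, hy0, hy⟩ := LangC1.greenberg
    (p : WittVector p (AlgebraicClosure (ZMod p))) (WittVector.irreducible p) g hg (by
      intro m
      obtain ⟨y, hy, hy'⟩ := LangC1.exists_primitive_approx p hd hn g hg (m + 1) m.succ_pos
      exact ⟨y, hy, (pow_dvd_pow _ m.le_succ).trans hy'⟩)
  exact LangC1.eval_eq_zero_of_multiple f c g hc hgf y hy0 hy
end

section
/- Let k be an algebraically closed field. Then the field k((t)) of formal Laurent series over k is C₁: every homogeneous polynomial over k((t)) of degree d in n variables with n > d has a nontrivial zero over k((t)). -/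
theorem lang_eval₂_smul {R S σ : Type*} [CommRing R] [CommRing S] {F : MvPolynomial σ R} {d : ℕ}
    (hF : F.IsHomogeneous d) (φ : R →+* S) (c : S) (x : σ → S) :
    MvPolynomial.eval₂ φ (c • x) F = c ^ d * MvPolynomial.eval₂ φ x F := by
  rw [MvPolynomial.eval₂_eq, MvPolynomial.eval₂_eq, Finset.mul_sum]
  refine Finset.sum_congr rfl fun m hm => ?_
  have h : ∑ i ∈ m.support, m i = d := by
    rw [← hF (MvPolynomial.mem_support_iff.1 hm)]
    simp [Finsupp.weight_apply, Finsupp.sum]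
  simp only [Pi.smul_apply, smul_eq_mul, mul_pow, Finset.prod_mul_distrib,
    Finset.prod_pow_eq_pow_sum]
  rw [← h]
  ring

open MvPolynomial in
theorem lang_common_zero {k : Type*} [Field k] [IsAlgClosed k] {σ : Type*} [Finite σ] (r : ℕ)
    (hr : r < Nat.card σ) (P : Fin r → MvPolynomial σ k) (hP : ∀ i, eval 0 (P i) = 0) :
    ∃ x : σ → k, x ≠ 0 ∧ ∀ i, eval x (P i) = 0 := by
  have hdim : ringKrullDim (MvPolynomial σ k) = (Nat.card σ : WithBot ℕ∞) := by
    rw [MvPolynomial.ringKrullDim_of_isNoetherianRing, ringKrullDim_eq_zero_of_field, zero_add]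
  have hM : ∃ M : Ideal (MvPolynomial σ k), M.IsMaximal ∧ (r : ℕ∞) < M.height := by
    by_contra! h
    have := (ringKrullDim_le_iff_isMaximal_height_le (R := MvPolynomial σ k) (r : WithBot ℕ∞)).2
      (fun M hM => by exact_mod_cast h M hM)
    rw [hdim] at this
    have : Nat.card σ ≤ r := by exact_mod_cast this
    omega
  obtain ⟨M, hM, hht⟩ := hM
  obtain ⟨a, rfl⟩ := isMaximal_iff_eq_vanishingIdeal_singleton.1 hM
  by_contra! hcon
  let T : MvPolynomial σ k →ₐ[k] MvPolynomial σ k := aeval (fun i => X i - C (a i))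
  have hT : ∀ (x : σ → k) p, eval x (T p) = eval (x - a) p := by
    intro x p
    have : (aeval x : MvPolynomial σ k →ₐ[k] k).comp T = aeval (x - a) := by
      ext i; simp [T]
    simpa using congrArg (fun φ => φ p) this
  let s : Set (MvPolynomial σ k) := Set.range (fun i => T (P i))
  have hz : zeroLocus k (Ideal.span s) = {a} := by
    rw [zeroLocus_span]
    ext x
    simp only [s, Set.mem_ofPred_eq, Set.forall_mem_range, Set.mem_singleton_iff]
    constructor
    · intro h
      by_contra hne
      obtain ⟨i, hi⟩ := hcon (x - a) (sub_ne_zero.2 hne)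
      exact hi (by rw [← hT]; simpa using h i)
    · rintro rfl i
      have := hT x (P i)
      rw [sub_self, hP] at this
      simpa using this
  have hrad : (Ideal.span s).radical = vanishingIdeal k {a} := by
    rw [← vanishingIdeal_zeroLocus_eq_radical (K := k), hz]
  have hmin : vanishingIdeal k {a} ∈ (Ideal.span s).minimalPrimes := by
    rw [← Ideal.radical_minimalPrimes, hrad]
    have := hM.isPrime
    rw [Ideal.minimalPrimes_eq_subsingleton_self]
    rfl
  have h1 := Ideal.height_le_card_of_mem_minimalPrimes_span (Set.finite_range _) hmin
  have h2 : s.ncard ≤ r := by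
    classical
    have h3 := Finset.card_image_le (s := (Finset.univ : Finset (Fin r))) (f := fun i => T (P i))
    rw [← Set.ncard_coe_finset] at h3
    simpa [s] using h3
  exact absurd (hht.trans_le h1) (by rw [not_lt]; exact_mod_cast h2)

open PowerSeries in
theorem lang_approx {k : Type*} [Field k] [IsAlgClosed k] (d n : ℕ) (hd : 0 < d)
    (hn : d < n) (F : MvPolynomial (Fin n) (PowerSeries k)) (hF : F.IsHomogeneous d) (N : ℕ) :
    ∃ x : Fin n → PowerSeries k, (∃ i, constantCoeff (x i) ≠ 0) ∧
      (X : PowerSeries k) ^ N ∣ MvPolynomial.eval x F := by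
  let s := N + 1
  let A := MvPolynomial (Fin n × Fin s) k
  let gx : Fin n → PowerSeries A :=
    fun i => ∑ j : Fin s, C (MvPolynomial.X (i, j)) * X ^ (j : ℕ)
  let Φ : PowerSeries A := MvPolynomial.eval₂ (PowerSeries.map MvPolynomial.C) gx F
  let ex : (Fin n × Fin s → k) → Fin n → PowerSeries k :=
    fun a i => ∑ j : Fin s, C (a (i, j)) * X ^ (j : ℕ)
  have hev : ∀ a : Fin n × Fin s → k,
      PowerSeries.map (MvPolynomial.eval a) Φ = MvPolynomial.eval (ex a) F := by
    intro a
    simp only [Φ]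
    rw [MvPolynomial.hom_eval₂]
    change _ = MvPolynomial.eval₂ (RingHom.id _) (ex a) F
    congr 1
    · rw [← PowerSeries.map_comp]
      have : (MvPolynomial.eval a).comp MvPolynomial.C = RingHom.id k := by ext; simp
      rw [this]; ext; simp
    · ext1 i
      simp [gx, ex]
  obtain ⟨a, ha0, ha⟩ := lang_common_zero (k := k) (σ := Fin n × Fin s) (n * s - 1)
    (by have : 0 < n * s := Nat.mul_pos (by omega) (by omega)
        simp; omega) (fun m => coeff (m : ℕ) Φ) (by
      intro m
      have h0 : ex 0 = 0 := by ext1 i; simp [ex]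
      rw [← PowerSeries.coeff_map, hev, h0]
      have := lang_eval₂_smul hF (RingHom.id _) (0 : PowerSeries k) (0 : Fin n → PowerSeries k)
      rw [zero_smul, zero_pow (by omega), zero_mul] at this
      change coeff _ (MvPolynomial.eval₂ (RingHom.id _) 0 F) = 0
      rw [this]; simp)
  have hdvd : (X : PowerSeries k) ^ (n * s - 1) ∣ MvPolynomial.eval (ex a) F := by
    rw [X_pow_dvd_iff]
    intro m hm
    rw [← hev, coeff_map]
    exact ha ⟨m, hm⟩
  -- order of vanishing
  have hco : ∀ i (j : Fin s), coeff (j : ℕ) (ex a i) = a (i, j) := by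
    intro i j
    simp only [ex, map_sum, coeff_C_mul, coeff_X_pow]
    rw [Finset.sum_eq_single j] <;> simp
    intro b hb h
    exact absurd (Fin.ext h).symm hb
  have hex : ∃ v, ∃ i, coeff v (ex a i) ≠ 0 := by
    obtain ⟨⟨i, j⟩, hij⟩ := Function.ne_iff.1 ha0
    exact ⟨j, i, by rw [hco]; exact hij⟩
  have hvle : ∃ v, v < s ∧ ∃ i, coeff v (ex a i) ≠ 0 := by
    obtain ⟨⟨i, j⟩, hij⟩ := Function.ne_iff.1 ha0
    exact ⟨j, j.2, i, by rw [hco]; exact hij⟩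
  classical
  let v := Nat.find hex
  have hv := Nat.find_spec hex
  have hvs : v < s := by
    obtain ⟨w, hw, h⟩ := hvle
    exact (Nat.find_min' hex h).trans_lt hw
  have hdv : ∀ i, ∃ y, ex a i = X ^ v * y := by
    intro i
    have : X ^ v ∣ ex a i := by
      rw [X_pow_dvd_iff]
      intro m hm
      have := Nat.find_min hex hm
      push Not at this
      exact this i
    exact this
  choose y hy using hdv
  refine ⟨y, ?_, ?_⟩
  · obtain ⟨i, hi⟩ := hv
    refine ⟨i, ?_⟩
    rw [hy, show Nat.find hex = 0 + v by simp [v], mul_comm, coeff_mul_X_pow] at hi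
    simpa using hi
  · have hsm : ex a = (X ^ v : PowerSeries k) • y := by ext1 i; simp [hy]
    rw [hsm, show MvPolynomial.eval ((X ^ v : PowerSeries k) • y) F = _ from
      lang_eval₂_smul hF (RingHom.id _) _ y] at hdvd
    rw [← pow_mul] at hdvd
    have hle : v * d + N ≤ n * s - 1 := by
      have h1 : v * d ≤ N * d := Nat.mul_le_mul_right _ (by omega)
      have h2 : (d + 1) * s ≤ n * s := Nat.mul_le_mul_right _ hn
      have h3 : (d + 1) * s = N * d + d + N + 1 := by simp only [s]; ring
      omega
    have := (pow_dvd_pow X hle).trans hdvd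
    rw [pow_add] at this
    exact (mul_dvd_mul_iff_left (pow_ne_zero _ X_ne_zero)).1 this
universe u
open PowerSeries in
theorem lang_ultra {k : Type u} [Field k] {n : ℕ} (F : MvPolynomial (Fin n) (PowerSeries k))
    (h : ∀ N : ℕ, ∃ x : Fin n → PowerSeries k, (∃ i, constantCoeff (x i) ≠ 0) ∧
      (X : PowerSeries k) ^ N ∣ MvPolynomial.eval x F) :
    ∃ (K : Type u) (_ : Field K) (_ : Algebra k K) (x : Fin n → PowerSeries K), x ≠ 0 ∧
      MvPolynomial.eval₂ (PowerSeries.map (algebraMap k K)) x F = 0 := by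
  choose x hx0 hx using h
  let I : Ideal (ℕ → k) :=
    { carrier := {a | ∀ᶠ N in Filter.atTop, a N = 0}
      add_mem' := by
        intro a b ha hb
        filter_upwards [ha, hb] with N h1 h2
        simp [h1, h2]
      zero_mem' := by simp
      smul_mem' := by
        intro c a ha
        filter_upwards [ha] with N h1
        simp [h1] }
  have hI : I ≠ ⊤ := by
    rw [Ideal.ne_top_iff_one]
    intro h
    have h' : ∀ᶠ N : ℕ in Filter.atTop, (1 : ℕ → k) N = 0 := h
    simp at h'
    obtain ⟨a, ha⟩ := h'
    exact absurd (ha a) (lt_irrefl _)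
  obtain ⟨J, hJ, hIJ⟩ := Ideal.exists_le_maximal I hI
  let Y : Fin n → PowerSeries (ℕ → k) := fun i => PowerSeries.mk fun j N => coeff j (x N i)
  let Φ : PowerSeries (ℕ → k) :=
    MvPolynomial.eval₂ (PowerSeries.map (algebraMap k (ℕ → k))) Y F
  have hΦ : ∀ N, PowerSeries.map (Pi.evalRingHom (fun _ : ℕ => k) N) Φ
      = MvPolynomial.eval (x N) F := by
    intro N
    simp only [Φ]
    rw [MvPolynomial.hom_eval₂]
    change _ = MvPolynomial.eval₂ (RingHom.id _) (x N) F
    congr 1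
    ext i j; simp [Y]
  have hΦI : ∀ j, coeff j Φ ∈ I := by
    intro j
    change ∀ᶠ N : ℕ in Filter.atTop, (coeff j Φ) N = 0
    filter_upwards [Filter.eventually_gt_atTop j] with N hN
    have h1 := X_pow_dvd_iff.1 (hx N) j hN
    rw [← hΦ, coeff_map] at h1
    exact h1
  let _ : Field ((ℕ → k) ⧸ J) := Ideal.Quotient.field J
  refine ⟨(ℕ → k) ⧸ J, inferInstance, Ideal.Quotient.algebra k,
    fun i => PowerSeries.map (Ideal.Quotient.mk J) (Y i), ?_, ?_⟩
  · intro h0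
    apply hJ.ne_top
    rw [Ideal.eq_top_iff_one]
    choose i hi using hx0
    have hc : ∀ l, (fun N => constantCoeff (x N l)) ∈ J := by
      intro l
      have h1 := congrArg (coeff 0) (congrFun h0 l)
      simp only [coeff_map, Pi.zero_apply, map_zero] at h1
      rw [Ideal.Quotient.eq_zero_iff_mem] at h1
      convert! h1 using 2
      simp [Y]
    have h1 : (1 : ℕ → k) = ∑ l : Fin n, (fun N => if l = i N then (constantCoeff (x N l))⁻¹ else 0)
        * (fun N => constantCoeff (x N l)) := by
      ext N
      rw [Finset.sum_apply]
      simp [hi N]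
    rw [h1]
    exact Ideal.sum_mem _ fun l _ => Ideal.mul_mem_left _ _ (hc l)
  · have h1 : PowerSeries.map (Ideal.Quotient.mk J) Φ = 0 := by
      ext j
      rw [coeff_map, map_zero, Ideal.Quotient.eq_zero_iff_mem]
      exact hIJ (hΦI j)
    simp only [Φ] at h1
    rw [MvPolynomial.hom_eval₂, ← PowerSeries.map_comp] at h1
    exact h1

open PowerSeries in
theorem lang_contract {k : Type*} [Field k] (T : PowerSeries k → PowerSeries k)
    (hT : ∀ n a b, (X : PowerSeries k) ^ n ∣ a - b → X ^ (n + 1) ∣ T a - T b) :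
    ∃ r, T r = r := by
  let r : ℕ → PowerSeries k := fun n => T^[n] 0
  have hr : ∀ n, r (n + 1) = T (r n) := fun n => Function.iterate_succ_apply' T n 0
  have h1 : ∀ n, (X : PowerSeries k) ^ n ∣ r (n + 1) - r n := by
    intro n
    induction n with
    | zero => simp
    | succ n ih => rw [hr (n + 1), hr n]; exact hT _ _ _ (by rw [← hr n]; exact ih)
  have h2 : ∀ n m, n ≤ m → (X : PowerSeries k) ^ n ∣ r m - r n := by
    intro n m hm
    induction m, hm using Nat.le_induction with
    | base => simp
    | succ m hm ih =>
      have := dvd_add ((pow_dvd_pow X hm).trans (h1 m)) ih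
      simpa using this
  let ρ : PowerSeries k := PowerSeries.mk fun j => coeff j (r (j + 1))
  have h3 : ∀ n, (X : PowerSeries k) ^ n ∣ ρ - r n := by
    intro n
    rw [X_pow_dvd_iff]
    intro m hm
    have := X_pow_dvd_iff.1 (h2 (m + 1) n hm) m (by omega)
    rw [map_sub, sub_eq_zero] at this
    simp [ρ, this]
  refine ⟨ρ, ?_⟩
  rw [← sub_eq_zero]
  ext n
  have h4 : (X : PowerSeries k) ^ (n + 1) ∣ T ρ - ρ := by
    have a1 := hT n _ _ (h3 n)
    rw [← hr] at a1
    have := dvd_sub a1 (h3 (n + 1))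
    simpa using this
  simpa using X_pow_dvd_iff.1 h4 n (by omega)

open PowerSeries in
theorem lang_hensel {k : Type*} [Field k] (g : Polynomial (PowerSeries k)) (z₀ : PowerSeries k)
    (e : ℕ) (he : ¬ (X : PowerSeries k) ^ (e + 1) ∣ (Polynomial.derivative g).eval z₀)
    (hg : (X : PowerSeries k) ^ (2 * e + 1) ∣ g.eval z₀) :
    ∃ z, g.eval z = 0 ∧ (X : PowerSeries k) ^ (e + 1) ∣ z - z₀ := by
  set h := (Polynomial.derivative g).eval z₀ with hh
  have hh0 : h ≠ 0 := by rintro h0; rw [h0] at he; exact he (dvd_zero _)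
  obtain ⟨w, hw⟩ : (X : PowerSeries k) ^ h.order.toNat ∣ h := X_pow_order_dvd
  set v := h.order.toNat with hv
  have hve : v ≤ e := by
    by_contra hlt
    exact he ((pow_dvd_pow X (by omega)).trans ⟨w, hw⟩)
  have hwu : IsUnit w := by
    rw [PowerSeries.isUnit_iff_constantCoeff, isUnit_iff_ne_zero]
    have h1 := coeff_order hh0
    have h2 := coeff_mul_X_pow w v 0
    rw [zero_add] at h2
    rw [← hv, hw, mul_comm, h2] at h1
    simpa using h1
  obtain ⟨w', hw'⟩ := hwu.exists_right_inv
  obtain ⟨c, hc⟩ := hg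
  obtain ⟨q, hq⟩ : ∃ q : Polynomial (PowerSeries k), Polynomial.taylor z₀ g =
      Polynomial.C (g.eval z₀) + Polynomial.C h * Polynomial.X + Polynomial.X ^ 2 * q := by
    refine ⟨(Polynomial.taylor z₀ g).divX.divX, ?_⟩
    have a1 := Polynomial.divX_mul_X_add (Polynomial.taylor z₀ g)
    have a2 := Polynomial.divX_mul_X_add (Polynomial.taylor z₀ g).divX
    rw [Polynomial.coeff_divX, Polynomial.taylor_coeff_one] at a2
    rw [Polynomial.taylor_coeff_zero] at a1
    rw [hh]
    conv_lhs => rw [← a1, ← a2]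
    ring
  let u' := X ^ (2 * (e - v)) * c * w' ^ 2
  have hgu : g.eval z₀ = h ^ 2 * (X * u') := by
    have : (2 * e + 1) = 2 * v + 1 + 2 * (e - v) := by omega
    rw [hc, hw, this]
    simp only [u']
    calc _ = X ^ (2 * v + 1 + 2 * (e - v)) * c * 1 ^ 2 := by ring
      _ = X ^ (2 * v + 1 + 2 * (e - v)) * c * (w * w') ^ 2 := by rw [hw']
      _ = _ := by ring
  obtain ⟨r, hr⟩ := lang_contract (fun r : PowerSeries k =>
      -1 - (X * u') * r ^ 2 * q.eval (h * (X * u') * r)) (by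
    intro n a b hab
    let Q : Polynomial (PowerSeries k) := Polynomial.X ^ 2 *
      q.comp (Polynomial.C (h * (X * u')) * Polynomial.X)
    have hQ : ∀ a, Q.eval a = a ^ 2 * q.eval (h * (X * u') * a) := by intro a; simp [Q]
    have h1 := hab.trans (Polynomial.sub_dvd_eval_sub a b Q)
    rw [hQ, hQ] at h1
    have h2 : (X : PowerSeries k) ^ (n + 1) ∣ X * (a ^ 2 * q.eval (h * (X * u') * a) -
      b ^ 2 * q.eval (h * (X * u') * b)) := by
      rw [pow_succ']; exact mul_dvd_mul_left _ h1
    convert! (dvd_mul_of_dvd_left h2 (-u')) using 1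
    ring)
  refine ⟨z₀ + h * (X * u') * r, ?_, ?_⟩
  · have h1 := Polynomial.taylor_eval z₀ g (h * (X * u') * r)
    rw [add_comm, ← h1, hq]
    simp only [Polynomial.eval_add, Polynomial.eval_mul, Polynomial.eval_C, Polynomial.eval_X,
      Polynomial.eval_pow]
    rw [hgu]
    linear_combination (-h ^ 2 * (X * u')) * hr
  · rw [add_sub_cancel_left, hw]
    simp only [u']
    refine ⟨w * X ^ (e - v) * c * w' ^ 2 * r, ?_⟩
    obtain ⟨f, rfl⟩ := Nat.exists_eq_add_of_le hve
    simp only [Nat.add_sub_cancel_left]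
    ring
theorem lang_exists_algHom {k : Type*} [Field k] [IsAlgClosed k] (A : Type*) [CommRing A]
    [Nontrivial A] [Algebra k A] [Algebra.FiniteType k A] : Nonempty (A →ₐ[k] k) := by
  obtain ⟨M, hM⟩ := Ideal.exists_maximal A
  let _ : Field (A ⧸ M) := Ideal.Quotient.field M
  have : Algebra.FiniteType k (A ⧸ M) :=
    Algebra.FiniteType.of_surjective (Ideal.Quotient.mkₐ k M) (Ideal.Quotient.mkₐ_surjective k M)
  have : Module.Finite k (A ⧸ M) := finite_of_finite_type_of_isJacobsonRing k (A ⧸ M)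
  have : Algebra.IsAlgebraic k (A ⧸ M) := Algebra.IsAlgebraic.of_finite k _
  exact ⟨(IsAlgClosed.lift : (A ⧸ M) →ₐ[k] k).comp (Ideal.Quotient.mkₐ k M)⟩

open PowerSeries in
theorem lang_specialize {k K : Type*} [Field k] [IsAlgClosed k] [Field K] [Algebra k K]
    {σ : Type*} [Finite σ] (G Q : MvPolynomial σ (PowerSeries k)) (w : σ → PowerSeries K)
    (hG : MvPolynomial.eval₂ (PowerSeries.map (algebraMap k K)) w G = 0) (e : ℕ)
    (hQ : coeff e (MvPolynomial.eval₂ (PowerSeries.map (algebraMap k K)) w Q) ≠ 0)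
    (N : ℕ) (hN : e < N) :
    ∃ w₀ : σ → PowerSeries k, (X : PowerSeries k) ^ N ∣ MvPolynomial.eval w₀ G ∧
      coeff e (MvPolynomial.eval w₀ Q) ≠ 0 := by
  set q := coeff e (MvPolynomial.eval₂ (PowerSeries.map (algebraMap k K)) w Q) with hq
  let S : Set K := insert q⁻¹ (Set.range fun p : σ × Fin N => coeff (p.2 : ℕ) (w p.1))
  have hS : S.Finite := (Set.finite_range _).insert _
  let A := Algebra.adjoin k S
  have : Algebra.FiniteType k A := by
    rw [← Subalgebra.fg_iff_finiteType]
    exact Subalgebra.fg_def.2 ⟨S, hS, rfl⟩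
  obtain ⟨ρ⟩ := lang_exists_algHom (k := k) A
  let wA : σ → PowerSeries A := fun i => PowerSeries.mk fun j =>
    if h : j < N then ⟨coeff j (w i), Algebra.subset_adjoin (Or.inr ⟨(i, ⟨j, h⟩), rfl⟩)⟩ else 0
  let Φ : MvPolynomial σ (PowerSeries k) → PowerSeries A :=
    fun P => MvPolynomial.eval₂ (PowerSeries.map (algebraMap k A)) wA P
  let w₀ : σ → PowerSeries k := fun i => PowerSeries.map (ρ : A →+* k) (wA i)
  have h1 : ∀ P, PowerSeries.map (ρ : A →+* k) (Φ P) = MvPolynomial.eval w₀ P := by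
    intro P
    simp only [Φ]
    rw [MvPolynomial.hom_eval₂, ← PowerSeries.map_comp]
    change _ = MvPolynomial.eval₂ (RingHom.id _) w₀ P
    have : (ρ : A →+* k).comp (algebraMap k A) = RingHom.id k := by ext; simp
    rw [this]
    congr 1
  have h2 : ∀ P, (X : PowerSeries K) ^ N ∣ PowerSeries.map (A.val : A →+* K) (Φ P) -
      MvPolynomial.eval₂ (PowerSeries.map (algebraMap k K)) w P := by
    intro P
    rw [← Ideal.mem_span_singleton, ← Ideal.Quotient.mk_eq_mk_iff_sub_mem]
    simp only [Φ]
    rw [MvPolynomial.hom_eval₂, MvPolynomial.hom_eval₂, MvPolynomial.hom_eval₂,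
      ← PowerSeries.map_comp]
    congr 1
    ext1 i
    rw [Ideal.Quotient.mk_eq_mk_iff_sub_mem, Ideal.mem_span_singleton, X_pow_dvd_iff]
    intro m hm
    simp [wA, hm]
  have h3 : ∀ P j, j < N → ((coeff j (Φ P) : A) : K) =
      coeff j (MvPolynomial.eval₂ (PowerSeries.map (algebraMap k K)) w P) := by
    intro P j hj
    have := X_pow_dvd_iff.1 (h2 P) j hj
    rw [map_sub, sub_eq_zero] at this
    simpa using this
  refine ⟨w₀, ?_, ?_⟩
  · rw [X_pow_dvd_iff]
    intro m hm
    have h4 := h3 G m hm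
    rw [hG, map_zero] at h4
    have h5 : coeff m (Φ G) = 0 := Subtype.ext h4
    rw [← h1, coeff_map, h5, map_zero]
  · rw [← h1, coeff_map]
    have h4 := h3 Q e hN
    rw [← hq] at h4
    have h5 : coeff e (Φ Q) * ⟨q⁻¹, Algebra.subset_adjoin (Or.inl rfl)⟩ = 1 := by
      apply Subtype.ext
      simp only [MulMemClass.coe_mul, OneMemClass.coe_one]
      rw [h4]
      exact mul_inv_cancel₀ hQ
    have h6 := congrArg ρ h5
    rw [map_mul, map_one] at h6
    exact left_ne_zero_of_mul_eq_one h6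

/-- evaluation of a polynomial with multivariate-polynomial coefficients -/
noncomputable def langEv {O B σ : Type*} [CommRing O] [CommRing B] (φ : O →+* B) (y : σ → B) (z : B) :
    Polynomial (MvPolynomial σ O) →+* B :=
  Polynomial.eval₂RingHom (MvPolynomial.eval₂Hom φ y) z

theorem langEv_option {O B σ : Type*} [CommRing O] [CommRing B] (φ : O →+* B) (y : σ → B) (z : B)
    (P : Polynomial (MvPolynomial σ O)) : langEv φ y z P =
    MvPolynomial.eval₂ φ (fun o : Option σ => o.elim z y)
      ((MvPolynomial.optionEquivLeft O σ).symm P) := by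
  obtain ⟨P, rfl⟩ := (MvPolynomial.optionEquivLeft O σ).surjective P
  rw [AlgEquiv.symm_apply_apply]
  have : (langEv φ y z).comp (MvPolynomial.optionEquivLeft O σ : _ →+* _) =
      MvPolynomial.eval₂Hom φ (fun o : Option σ => o.elim z y) := by
    apply MvPolynomial.ringHom_ext
    · intro r
      simp [langEv, MvPolynomial.optionEquivLeft_C]
    · intro o
      cases o with
      | none => simp [langEv, MvPolynomial.optionEquivLeft_X_none]
      | some i => simp [langEv, MvPolynomial.optionEquivLeft_X_some]
  exact congrArg (fun f => f P) this

theorem langEv_comp {O B D σ : Type*} [CommRing O] [CommRing B] [CommRing D] (φ : O →+* B)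
    (ψ : B →+* D) (y : σ → B) (z : B) (P : Polynomial (MvPolynomial σ O)) :
    ψ (langEv φ y z P) = langEv (ψ.comp φ) (ψ ∘ y) (ψ z) P := by
  simp only [langEv, Polynomial.coe_eval₂RingHom]
  rw [Polynomial.hom_eval₂]
  congr 1
  apply MvPolynomial.ringHom_ext <;> simp

open PowerSeries in
theorem lang_point {k K : Type*} [Field k] [IsAlgClosed k] [Field K] [Algebra k K]
    {σ : Type*} [Finite σ] (G A : Polynomial (MvPolynomial σ (PowerSeries k)))
    (y : σ → PowerSeries K) (z : PowerSeries K)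
    (hG : langEv (PowerSeries.map (algebraMap k K)) y z G = 0)
    (hG' : langEv (PowerSeries.map (algebraMap k K)) y z (Polynomial.derivative G) ≠ 0)
    (hA : langEv (PowerSeries.map (algebraMap k K)) y z A ≠ 0) :
    ∃ (y₀ : σ → PowerSeries k) (z₀ : PowerSeries k), langEv (RingHom.id _) y₀ z₀ G = 0 ∧
      langEv (RingHom.id _) y₀ z₀ A ≠ 0 := by
  have hQ : langEv (PowerSeries.map (algebraMap k K)) y z (Polynomial.derivative G * A) ≠ 0 := by
    rw [map_mul]; exact mul_ne_zero hG' hA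
  obtain ⟨e, he⟩ : ∃ e, coeff e (langEv (PowerSeries.map (algebraMap k K)) y z
      (Polynomial.derivative G * A)) ≠ 0 := by
    by_contra! h
    exact hQ (PowerSeries.ext (by simpa using h))
  rw [langEv_option] at hG he
  obtain ⟨w, hw1, hw2⟩ := lang_specialize _ _ _ hG e he (2 * e + 1) (by omega)
  let y₀ : σ → PowerSeries k := fun i => w (some i)
  have hw : w = fun o : Option σ => o.elim (w none) y₀ := by
    ext1 o; cases o <;> rfl
  have hev : ∀ P, MvPolynomial.eval w ((MvPolynomial.optionEquivLeft _ σ).symm P) =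
      langEv (RingHom.id _) y₀ (w none) P := by
    intro P
    rw [langEv_option, ← hw]
    rfl
  rw [hev] at hw1 hw2
  let φ : MvPolynomial σ (PowerSeries k) →+* PowerSeries k :=
    MvPolynomial.eval₂Hom (RingHom.id _) y₀
  have hev2 : ∀ z P, langEv (RingHom.id _) y₀ z P = (P.map φ).eval z := by
    intro z P
    simp [langEv, φ, Polynomial.eval_map]
  have hnd : ¬ (X : PowerSeries k) ^ (e + 1) ∣
      langEv (RingHom.id _) y₀ (w none) (Polynomial.derivative G * A) := by
    intro h
    exact hw2 (X_pow_dvd_iff.1 h e (by omega))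
  rw [map_mul] at hnd
  rw [hev2] at hw1
  obtain ⟨z₀, hz, hz'⟩ := lang_hensel (G.map φ) (w none) e (by
    intro h
    rw [Polynomial.derivative_map, ← hev2] at h
    exact hnd (dvd_mul_of_dvd_left h _)) hw1
  refine ⟨y₀, z₀, by rw [hev2, hz], ?_⟩
  intro h0
  apply hnd
  apply dvd_mul_of_dvd_right
  have h1 := hz'.trans (Polynomial.sub_dvd_eval_sub z₀ (w none) (A.map φ))
  rw [← hev2, ← hev2, h0, zero_sub] at h1
  exact (dvd_neg.1 h1)
open PowerSeries in
theorem lang_coeff_pow {K : Type*} [Field K] (p : ℕ) [Fact p.Prime] [CharP K p] (w : PowerSeries K)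
    (m : ℕ) : coeff m (w ^ p) = if p ∣ m then (coeff (m / p) w) ^ p else 0 := by
  have hp : p ≠ 0 := (Fact.out : p.Prime).ne_zero
  have : ExpChar K p := ExpChar.prime Fact.out
  have h : PowerSeries.map (frobenius K p) (PowerSeries.expand p hp w) = w ^ p :=
    MvPowerSeries.map_frobenius_expand p hp
  rw [← h, coeff_map, coeff_expand]
  split_ifs with h
  · rfl
  · simp

open PowerSeries in
theorem lang_coeff_sum {K : Type*} [Field K] (p : ℕ) [Fact p.Prime] [CharP K p]
    (w : ℕ → PowerSeries K) (N : ℕ) :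
    coeff N (∑ r ∈ Finset.range p, X ^ r * w r ^ p) = (coeff (N / p) (w (N % p))) ^ p := by
  have hp : 0 < p := (Fact.out : p.Prime).pos
  rw [map_sum, Finset.sum_eq_single (N % p)]
  · rw [coeff_X_pow_mul', if_pos (Nat.mod_le _ _), lang_coeff_pow, if_pos (Nat.dvd_sub_mod N)]
    congr 3
    rw [show N - N % p = p * (N / p) by have := Nat.div_add_mod N p; omega,
      Nat.mul_div_cancel_left _ hp]
  · intro r hr hne
    rw [Finset.mem_range] at hr
    rw [coeff_X_pow_mul']
    split_ifs with h
    · rw [lang_coeff_pow, if_neg]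
      intro hdvd
      apply hne
      have : r ≡ N [MOD p] := (Nat.modEq_iff_dvd' h).2 hdvd
      rw [← this, Nat.mod_eq_of_lt hr]
    · rfl
  · intro h
    exact absurd (Finset.mem_range.2 (Nat.mod_lt _ hp)) h

open PowerSeries in
theorem lang_pcond_O {k K : Type*} [Field k] [IsAlgClosed k] [Field K] [Algebra k K]
    (p : ℕ) [Fact p.Prime] [CharP k p] {ι : Type*} (s : Finset ι)
    (c : ι → PowerSeries k) (v : ι → PowerSeries K)
    (h : ∑ i ∈ s, PowerSeries.map (algebraMap k K) (c i) * v i ^ p = 0)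
    (hv : ∀ d : ι → PowerSeries k,
      ∑ i ∈ s, PowerSeries.map (algebraMap k K) (d i) * v i = 0 → ∀ i ∈ s, d i = 0) :
    ∀ i ∈ s, c i = 0 := by
  have hp : 0 < p := (Fact.out : p.Prime).pos
  have : CharP K p := charP_of_injective_algebraMap (algebraMap k K).injective p
  have : CharP (PowerSeries K) p :=
    charP_of_injective_ringHom (f := PowerSeries.C (R := K)) PowerSeries.C_injective p
  have hroot : ∀ a : k, ∃ b : k, b ^ p = a := fun a => IsAlgClosed.exists_pow_nat_eq a hp
  choose rt hrt using hroot
  let d : ℕ → ι → PowerSeries k := fun r i =>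
    PowerSeries.mk fun m => rt (coeff (p * m + r) (c i))
  have hc : ∀ i, c i = ∑ r ∈ Finset.range p, X ^ r * d r i ^ p := by
    intro i
    ext N
    rw [lang_coeff_sum p (fun r => d r i)]
    simp only [d, coeff_mk, hrt]
    rw [Nat.div_add_mod]
  let W : ℕ → PowerSeries K := fun r => ∑ i ∈ s, PowerSeries.map (algebraMap k K) (d r i) * v i
  have hW : ∑ r ∈ Finset.range p, X ^ r * W r ^ p = 0 := by
    rw [← h]
    simp only [W]
    simp_rw [sum_pow_char p, Finset.mul_sum]
    rw [Finset.sum_comm]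
    refine Finset.sum_congr rfl fun i _ => ?_
    conv_rhs => rw [hc i]
    rw [map_sum, Finset.sum_mul]
    refine Finset.sum_congr rfl fun r _ => ?_
    rw [map_mul, map_pow, map_pow, PowerSeries.map_X, mul_pow, mul_assoc]
  have hW0 : ∀ r < p, W r = 0 := by
    intro r hr
    ext m
    have h1 := congrArg (coeff (p * m + r)) hW
    rw [lang_coeff_sum, Nat.mul_add_mod, Nat.mod_eq_of_lt hr, Nat.mul_add_div hp,
      Nat.div_eq_of_lt hr, add_zero, map_zero] at h1
    rw [map_zero]
    exact pow_eq_zero_iff hp.ne' |>.1 h1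
  intro i hi
  rw [hc i]
  refine Finset.sum_eq_zero fun r hr => ?_
  rw [hv (d r) (hW0 r (Finset.mem_range.1 hr)) i hi, zero_pow hp.ne', mul_zero]

open PowerSeries in
theorem lang_scale {K F' : Type*} [Field K] [Field F'] [Algebra (PowerSeries K) F']
    [IsFractionRing (PowerSeries K) F'] (u : F') : ∃ (m : ℕ) (o : PowerSeries K),
    algebraMap (PowerSeries K) F' (X ^ m) * u = algebraMap (PowerSeries K) F' o := by
  obtain ⟨a, b, hb, rfl⟩ := IsFractionRing.div_surjective (A := PowerSeries K) u
  have hb0 : b ≠ 0 := nonZeroDivisors.ne_zero hb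
  obtain ⟨w, hw⟩ : (X : PowerSeries K) ^ b.order.toNat ∣ b := X_pow_order_dvd
  set m := b.order.toNat with hm
  have hwu : IsUnit w := by
    rw [PowerSeries.isUnit_iff_constantCoeff, isUnit_iff_ne_zero]
    have h1 := coeff_order hb0
    have h2 := coeff_mul_X_pow w m 0
    rw [zero_add] at h2
    rw [← hm, hw, mul_comm, h2] at h1
    simpa using h1
  obtain ⟨w', hw'⟩ := hwu.exists_right_inv
  refine ⟨m, a * w', ?_⟩
  have hb1 : algebraMap (PowerSeries K) F' b ≠ 0 := by
    simpa using hb0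
  rw [mul_div_assoc', div_eq_iff hb1, ← map_mul, ← map_mul]
  congr 1
  rw [hw]
  calc X ^ m * a = X ^ m * a * 1 := by ring
    _ = X ^ m * a * (w * w') := by rw [hw']
    _ = _ := by ring

open PowerSeries in
theorem lang_pcond {k K F F' L : Type*} [Field k] [IsAlgClosed k] [Field K] [Algebra k K]
    [Field F] [Algebra (PowerSeries k) F] [IsFractionRing (PowerSeries k) F]
    [Field F'] [Algebra (PowerSeries K) F'] [IsFractionRing (PowerSeries K) F']
    [Algebra F F'] (hcomp : ∀ o : PowerSeries k, algebraMap F F' (algebraMap (PowerSeries k) F o) =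
      algebraMap (PowerSeries K) F' (PowerSeries.map (algebraMap k K) o))
    [Field L] [Algebra F L] (j : L →ₐ[F] F')
    (p : ℕ) [Fact p.Prime] [CharP k p] (s : Finset L)
    (hs : LinearIndepOn F _root_.id (s : Set L)) : LinearIndepOn F (· ^ p) (s : Set L) := by
  rw [linearIndepOn_finset_iff] at hs ⊢
  intro g hg
  choose m o ho using fun l : L => lang_scale (K := K) (j l)
  let e : L → F := fun l => algebraMap (PowerSeries k) F (X ^ m l)
  have he : ∀ l, e l ≠ 0 := by
    intro l
    simp [e, X_ne_zero]
  have hoe : ∀ l, algebraMap (PowerSeries K) F' (o l) = algebraMap F F' (e l) * j l := by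
    intro l
    rw [← ho, hcomp]
    simp
  obtain ⟨b, hb⟩ := IsLocalization.exist_integer_multiples (nonZeroDivisors (PowerSeries k)) s
    (fun l => g l / e l ^ p)
  choose! C hC using hb
  have hinj : Function.Injective (algebraMap (PowerSeries K) F') := IsFractionRing.injective _ _
  have hinj' : Function.Injective (algebraMap (PowerSeries k) F) := IsFractionRing.injective _ _
  have hb0 : algebraMap (PowerSeries k) F b ≠ 0 := by
    simp
  have hC' : ∀ l ∈ s, algebraMap (PowerSeries k) F (C l) =
      algebraMap (PowerSeries k) F b * (g l / e l ^ p) := by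
    intro l hl
    rw [hC l hl, Algebra.smul_def]
  have key := lang_pcond_O (K := K) p s C o (by
    apply hinj
    rw [map_sum, map_zero]
    have h1 := congrArg (fun x => algebraMap F F' (algebraMap (PowerSeries k) F b) * j x) hg
    simp only [map_sum, map_zero, mul_zero, Finset.mul_sum] at h1
    rw [← h1]
    refine Finset.sum_congr rfl fun l hl => ?_
    rw [map_mul, map_pow, hoe, ← hcomp, hC' l hl, map_smul, Algebra.smul_def, map_mul, map_pow,
      map_div₀, map_pow, mul_pow]
    have : algebraMap F F' (e l) ≠ 0 := by simpa using he l
    field_simp) (by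
    intro d hd l hl
    have h2 := congrArg (algebraMap (PowerSeries K) F') hd
    rw [map_sum, map_zero] at h2
    have h3 : ∑ l ∈ s, (algebraMap (PowerSeries k) F (d l) * e l) • _root_.id l = 0 := by
      have hj : Function.Injective j := j.toRingHom.injective
      apply hj
      rw [map_sum, map_zero, ← h2]
      refine Finset.sum_congr rfl fun l hl => ?_
      rw [map_smul, map_mul, hoe, ← hcomp, Algebra.smul_def, map_mul, mul_assoc]
      rfl
    have h4 := hs _ h3 l hl
    have h5 := (mul_eq_zero.1 h4).resolve_right (he l)
    exact hinj' (by rw [h5, map_zero]))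
  intro l hl
  have h6 := hC' l hl
  rw [key l hl, map_zero] at h6
  have h7 := (mul_eq_zero.1 h6.symm).resolve_left hb0
  exact (div_eq_zero_iff.1 h7).resolve_right (pow_ne_zero _ (he l))
theorem lang_clear {O F σ : Type*} [CommRing O] [IsDomain O] [Field F] [Algebra O F]
    [IsFractionRing O F] (r : MvPolynomial σ F) : ∃ (c : O) (r' : MvPolynomial σ O), c ≠ 0 ∧
    MvPolynomial.map (algebraMap O F) r' = MvPolynomial.C (algebraMap O F c) * r := by
  classical
  obtain ⟨b, hb⟩ := IsLocalization.exist_integer_multiples (nonZeroDivisors O) r.support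
    (fun m => r.coeff m)
  choose! C hC using hb
  refine ⟨b, ∑ m ∈ r.support, MvPolynomial.monomial m (C m), nonZeroDivisors.ne_zero b.2, ?_⟩
  rw [map_sum]
  conv_rhs => rw [MvPolynomial.as_sum r]
  rw [Finset.mul_sum]
  refine Finset.sum_congr rfl fun m hm => ?_
  rw [MvPolynomial.map_monomial, hC m hm, MvPolynomial.C_mul_monomial, Algebra.smul_def]

theorem lang_gen {O F L σ : Type*} [CommRing O] [IsDomain O] [Field F] [Algebra O F]
    [IsFractionRing O F] [Field L] [Algebra F L] (y : σ → L) (hy : AlgebraicIndependent F y)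
    [Algebra.IsSeparable (IntermediateField.adjoin F (Set.range y)) L] (z : L)
    (hz : IntermediateField.adjoin (IntermediateField.adjoin F (Set.range y)) {z} = ⊤)
    (φ : O →+* L) (hφ : φ = (algebraMap F L).comp (algebraMap O F)) :
    ∃ G, langEv φ y z G = 0 ∧ langEv φ y z (Polynomial.derivative G) ≠ 0 ∧
      (∀ P, langEv φ y z P = 0 → ∃ B, langEv φ y z B ≠ 0 ∧ G ∣ B * P) ∧
      ∀ u, ∃ b A, langEv φ y z b ≠ 0 ∧ langEv φ y z A = langEv φ y z b * u := by
  set E := IntermediateField.adjoin F (Set.range y) with hE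
  let S := MvPolynomial σ O
  have hmap : ∀ r : S, MvPolynomial.eval₂ φ y r =
      MvPolynomial.aeval y (MvPolynomial.map (algebraMap O F) r) := by
    intro r
    rw [MvPolynomial.aeval_def, MvPolynomial.eval₂_map, hφ]
  have hyE : ∀ i, y i ∈ E := fun i => IntermediateField.subset_adjoin _ _ ⟨i, rfl⟩
  let ε : S →+* E := MvPolynomial.eval₂Hom ((algebraMap F E).comp (algebraMap O F))
    (fun i => ⟨y i, hyE i⟩)
  have hε : ∀ r : S, algebraMap E L (ε r) = MvPolynomial.eval₂ φ y r := by
    intro r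
    have : (algebraMap E L).comp ε = MvPolynomial.eval₂Hom φ y := by
      apply MvPolynomial.ringHom_ext
      · intro a
        simp [ε, hφ]
      · intro i
        simp [ε]
    exact congrArg (fun f => f r) this
  have hεinj : Function.Injective ε := by
    rw [injective_iff_map_eq_zero]
    intro r hr
    have h1 := hε r
    rw [hr, map_zero, hmap] at h1
    have h2 := (injective_iff_map_eq_zero (MvPolynomial.aeval (R := F) y)).1 hy _ h1.symm
    exact (MvPolynomial.map_injective _ (IsFractionRing.injective O F)) (by rw [h2, map_zero])
  let : Algebra S E := ε.toAlgebra
  have hal : algebraMap S E = ε := rfl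
  have : FaithfulSMul S E := (faithfulSMul_iff_algebraMap_injective S E).2 hεinj
  have : IsFractionRing S E := by
    apply IsFractionRing.of_field
    rintro ⟨u, hu⟩
    obtain ⟨r, s, hrs⟩ := (IntermediateField.mem_adjoin_range_iff F y u).1 hu
    obtain ⟨c, r', hc, hr'⟩ := lang_clear (O := O) r
    obtain ⟨c', s', hc', hs'⟩ := lang_clear (O := O) s
    refine ⟨MvPolynomial.C c' * r', MvPolynomial.C c * s', ?_⟩
    apply (algebraMap E L).injective
    rw [map_div₀, hal, hε, hε, hmap, hmap]
    simp only [map_mul, hr', hs', MvPolynomial.map_C, MvPolynomial.aeval_C]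
    have h1 : algebraMap F L (algebraMap O F c) ≠ 0 := by simpa using hc
    have h2 : algebraMap F L (algebraMap O F c') ≠ 0 := by simpa using hc'
    change u = _
    rw [hrs]
    by_cases h3 : MvPolynomial.aeval y s = 0
    · simp [h3]
    · field_simp
  have hev : ∀ P : Polynomial S, langEv φ y z P =
      Polynomial.aeval z (P.map (algebraMap S E)) := by
    intro P
    simp only [langEv, Polynomial.coe_eval₂RingHom]
    rw [Polynomial.aeval_def, Polynomial.eval₂_map]
    congr 1
    exact RingHom.ext fun r => (hε r).symm
  have hevC : ∀ b : S, b ≠ 0 → langEv φ y z (Polynomial.C b) ≠ 0 := by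
    intro b hb
    rw [hev]
    simpa using hb
  have hclear : ∀ q : Polynomial E, ∃ (b : S) (Q : Polynomial S), b ≠ 0 ∧
      Q.map (algebraMap S E) = Polynomial.C (algebraMap S E b) * q := by
    intro q
    obtain ⟨b, hb, h⟩ := IsLocalization.integerNormalization_spec (nonZeroDivisors S) q
    refine ⟨b, IsLocalization.integerNormalization (nonZeroDivisors S) q,
      nonZeroDivisors.ne_zero hb, ?_⟩
    rw [h, ← Polynomial.smul_eq_C_mul, algebraMap_smul]
  have hsep : IsSeparable E z := Algebra.IsSeparable.isSeparable E z
  have hzint : IsIntegral E z := hsep.isIntegral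
  obtain ⟨b, G, hb, hG⟩ := hclear (minpoly E z)
  refine ⟨G, ?_, ?_, ?_, ?_⟩
  · rw [hev, hG, map_mul, minpoly.aeval, mul_zero]
  · rw [hev, ← Polynomial.derivative_map, hG, Polynomial.derivative_C_mul, map_mul]
    refine mul_ne_zero ?_ (hsep.aeval_derivative_ne_zero (minpoly.aeval _ _))
    simpa using hb
  · intro P hP
    rw [hev] at hP
    obtain ⟨Q, hQ⟩ := minpoly.dvd E z hP
    obtain ⟨c, Q', hc, hQ'⟩ := hclear Q
    refine ⟨Polynomial.C (b * c), hevC _ (mul_ne_zero hb hc), Q', ?_⟩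
    apply Polynomial.map_injective _ (IsFractionRing.injective S E)
    rw [Polynomial.map_mul, Polynomial.map_mul, hG, hQ', hQ, Polynomial.map_C, map_mul,
      Polynomial.C_mul]
    ring
  · intro u
    have hu : u ∈ IntermediateField.adjoin E {z} := by rw [hz]; trivial
    rw [← IntermediateField.mem_toSubalgebra,
      IntermediateField.adjoin_simple_toSubalgebra_of_isAlgebraic hzint.isAlgebraic,
      Algebra.adjoin_singleton_eq_range_aeval] at hu
    obtain ⟨q, hq⟩ := hu
    obtain ⟨c, A, hc, hA⟩ := hclear q
    refine ⟨Polynomial.C c, A, hevC _ hc, ?_⟩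
    rw [hev, hev, hA, map_mul, Polynomial.map_C]
    congr 1
open PowerSeries in
theorem lang_sepgen {k K F F' L : Type*} [Field k] [IsAlgClosed k] [Field K] [Algebra k K]
    [Field F] [Algebra (PowerSeries k) F] [IsFractionRing (PowerSeries k) F]
    [Field F'] [Algebra (PowerSeries K) F'] [IsFractionRing (PowerSeries K) F']
    [Algebra F F'] (hcomp : ∀ o : PowerSeries k, algebraMap F F' (algebraMap (PowerSeries k) F o) =
      algebraMap (PowerSeries K) F' (PowerSeries.map (algebraMap k K) o))
    [Field L] [Algebra F L] (j : L →ₐ[F] F') [Algebra.EssFiniteType F L] :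
    ∃ s : Finset L, IsTranscendenceBasis F ((↑) : s → L) ∧
      Algebra.IsSeparable (IntermediateField.adjoin F (s : Set L)) L := by
  have hinj : Function.Injective ((algebraMap (PowerSeries k) F).comp (C (R := k))) :=
    RingHom.injective _
  obtain _ | ⟨p, hp, hpk⟩ := CharP.exists' k
  · have : CharZero F := (RingHom.charZero_iff hinj).1 inferInstance
    exact exists_isTranscendenceBasis_and_isSeparable_of_perfectField F L
  · have : CharP F p := (RingHom.charP_iff _ hinj p).1 hpk
    have : ExpChar F p := ExpChar.prime hp.out
    exact exists_isTranscendenceBasis_and_isSeparable_of_linearIndepOn_pow_of_essFiniteType p hp.out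
      (fun s hs => lang_pcond hcomp j p s hs)

open PowerSeries in
theorem lang_struct {k K F F' L : Type*} [Field k] [IsAlgClosed k] [Field K] [Algebra k K]
    [Field F] [Algebra (PowerSeries k) F] [IsFractionRing (PowerSeries k) F]
    [Field F'] [Algebra (PowerSeries K) F'] [IsFractionRing (PowerSeries K) F']
    [Algebra F F'] (hcomp : ∀ o : PowerSeries k, algebraMap F F' (algebraMap (PowerSeries k) F o) =
      algebraMap (PowerSeries K) F' (PowerSeries.map (algebraMap k K) o))
    [Field L] [Algebra F L] (j : L →ₐ[F] F') [Algebra.EssFiniteType F L] (φ)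
    (hφ : φ = PowerSeries.map (algebraMap k K)) :
    ∃ (s : Finset L) (y : s → PowerSeries K) (z : PowerSeries K) (G : _),
      langEv φ y z G = 0 ∧ langEv φ y z (Polynomial.derivative G) ≠ 0 ∧
      (∀ P, langEv φ y z P = 0 → ∃ B, langEv φ y z B ≠ 0 ∧ G ∣ B * P) ∧
      ∀ (u : L) (o : PowerSeries K), j u = algebraMap _ F' o → ∃ b A, langEv φ y z b ≠ 0 ∧
        langEv φ y z A = langEv φ y z b * o := by
  obtain ⟨s, hs, hsep⟩ := lang_sepgen hcomp j
  choose m o ho using fun l : L => lang_scale (K := K) (j l)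
  let e : L → F := fun l => algebraMap (PowerSeries k) F (X ^ m l)
  have he : ∀ l, e l ≠ 0 := by
    intro l
    simp [e, X_ne_zero]
  have hoe : ∀ l, algebraMap (PowerSeries K) F' (o l) = j (algebraMap F L (e l) * l) := by
    intro l
    rw [← ho, map_mul, j.commutes, hcomp]
    simp
  have heL : ∀ l, algebraMap F L (e l) ≠ 0 := fun l => by simpa using he l
  let y : s → L := fun l => algebraMap F L (e l) * l
  have hy : AlgebraicIndependent F y := by
    have h1 := hs.1.polynomial_aeval_of_transcendental
      (f := fun l : s => Polynomial.C (e l) * Polynomial.X) (by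
        intro l
        apply Polynomial.transcendental
        · simp [Polynomial.natDegree_C_mul_X _ (he l)]
        · simpa using he l)
    simpa using h1
  have hrange : IntermediateField.adjoin F (s : Set L) =
      IntermediateField.adjoin F (Set.range y) := by
    apply le_antisymm
    · rw [IntermediateField.adjoin_le_iff]
      intro l hl
      have h1 : y ⟨l, hl⟩ ∈ IntermediateField.adjoin F (Set.range y) :=
        IntermediateField.subset_adjoin _ _ ⟨_, rfl⟩
      have h2 := mul_mem (IntermediateField.algebraMap_mem
        (IntermediateField.adjoin F (Set.range y)) (e l)⁻¹) h1
      have h3 : algebraMap F L (e l)⁻¹ * y ⟨l, hl⟩ = l := by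
        simp only [y, map_inv₀]
        field_simp [heL l]
      rwa [h3] at h2
    · rw [IntermediateField.adjoin_le_iff]
      rintro _ ⟨l, rfl⟩
      exact mul_mem (IntermediateField.algebraMap_mem _ _)
        (IntermediateField.subset_adjoin _ _ l.2)
  have halg : Algebra.IsSeparable (IntermediateField.adjoin F (Set.range y)) L := hrange ▸ hsep
  have hfin : FiniteDimensional (IntermediateField.adjoin F (Set.range y)) L := by
    have : Algebra.EssFiniteType (IntermediateField.adjoin F (Set.range y)) L :=
      Algebra.EssFiniteType.of_comp F _ L
    exact Algebra.finite_of_essFiniteType_of_isAlgebraic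
  obtain ⟨z, hz⟩ := Field.exists_primitive_element (IntermediateField.adjoin F (Set.range y)) L
  let z' := algebraMap F L (e z) * z
  have hz' : IntermediateField.adjoin (IntermediateField.adjoin F (Set.range y)) {z'} = ⊤ := by
    rw [eq_top_iff, ← hz, IntermediateField.adjoin_simple_le_iff]
    have h1 : z' ∈ IntermediateField.adjoin (IntermediateField.adjoin F (Set.range y)) {z'} :=
      IntermediateField.mem_adjoin_simple_self _ _
    have h2 := mul_mem (IntermediateField.algebraMap_mem (IntermediateField.adjoin
        (IntermediateField.adjoin F (Set.range y)) {z'}) (algebraMap F _ (e z)⁻¹)) h1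
    have h3 : algebraMap (IntermediateField.adjoin F (Set.range y)) L (algebraMap F _ (e z)⁻¹) * z'
        = z := by
      rw [← IsScalarTower.algebraMap_apply]
      simp only [z', map_inv₀]
      field_simp [heL z]
    rwa [h3] at h2
  obtain ⟨G, hG1, hG2, hG3, hG4⟩ := lang_gen (O := PowerSeries k) y hy z' hz' _ rfl
  have hinj : Function.Injective (algebraMap (PowerSeries K) F') := IsFractionRing.injective _ _
  have hj : Function.Injective j := j.toRingHom.injective
  have tr : ∀ P, algebraMap (PowerSeries K) F' (langEv φ (fun l : s => o l) (o z) P) =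
      j (langEv ((algebraMap F L).comp (algebraMap (PowerSeries k) F)) y z' P) := by
    intro P
    have h2 := langEv_comp ((algebraMap F L).comp (algebraMap (PowerSeries k) F))
      (j : L →+* F') y z' P
    have h3 : (j : L →+* F') (langEv ((algebraMap F L).comp (algebraMap (PowerSeries k) F)) y z' P)
      = j (langEv ((algebraMap F L).comp (algebraMap (PowerSeries k) F)) y z' P) := rfl
    rw [← h3, h2, langEv_comp]
    congr 2
    · ext1 a
      simp [hφ, hcomp]
    · ext1 l
      exact hoe _
    · exact hoe _
  have tr0 : ∀ P, langEv φ (fun l : s => o l) (o z) P = 0 ↔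
      langEv ((algebraMap F L).comp (algebraMap (PowerSeries k) F)) y z' P = 0 := by
    intro P
    rw [← map_eq_zero_iff _ hinj, tr, map_eq_zero_iff _ hj]
  refine ⟨s, fun l => o l, o z, G, (tr0 _).2 hG1, fun h => hG2 ((tr0 _).1 h), ?_, ?_⟩
  · intro P hP
    obtain ⟨B, hB, h⟩ := hG3 P ((tr0 _).1 hP)
    exact ⟨B, fun h' => hB ((tr0 _).1 h'), h⟩
  · intro u v huv
    obtain ⟨b, A, hb, h⟩ := hG4 u
    refine ⟨b, A, fun h' => hb ((tr0 _).1 h'), ?_⟩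
    apply hinj
    rw [map_mul, tr, tr, h, map_mul, huv]

theorem lang_main {k : Type*} [Field k] [IsAlgClosed k] (d n : ℕ) (hd : 0 < d)
    (hn : d < n) (f : MvPolynomial (Fin n) (PowerSeries k)) (hf : f.IsHomogeneous d) :
    ∃ x : Fin n → PowerSeries k, x ≠ 0 ∧ MvPolynomial.eval x f = 0 := by
  obtain ⟨K, _, _, x, hx0, hx⟩ := lang_ultra f (fun N => lang_approx d n hd hn f hf N)
  let F := FractionRing (PowerSeries k)
  let F' := FractionRing (PowerSeries K)
  have hmapinj : Function.Injective (PowerSeries.map (algebraMap k K)) :=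
    PowerSeries.map_injective _ (algebraMap k K).injective
  have hinj : Function.Injective ((algebraMap (PowerSeries K) F').comp
      (PowerSeries.map (algebraMap k K))) :=
    (IsFractionRing.injective (PowerSeries K) F').comp hmapinj
  let alg : Algebra F F' := (IsFractionRing.lift (K := F) hinj).toAlgebra
  have hcomp : ∀ o : PowerSeries k, algebraMap F F' (algebraMap (PowerSeries k) F o) =
      algebraMap (PowerSeries K) F' (PowerSeries.map (algebraMap k K) o) := by
    intro o
    exact IsFractionRing.lift_algebraMap hinj o
  let L := IntermediateField.adjoin F (Set.range fun i => algebraMap (PowerSeries K) F' (x i))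
  have hL : Algebra.EssFiniteType F L :=
    IntermediateField.essFiniteType_iff.2
      (IntermediateField.fg_adjoin_of_finite (Set.finite_range _))
  obtain ⟨s, y, z, G, hG1, hG2, hG3, hG4⟩ := lang_struct hcomp L.val _ rfl
  set φ := PowerSeries.map (algebraMap k K) with hφ
  choose b A hb hA using fun i => hG4 (⟨algebraMap (PowerSeries K) F' (x i),
    IntermediateField.subset_adjoin _ _ ⟨i, rfl⟩⟩ : L) (x i) rfl
  let B := ∏ i, b i
  have hB : langEv φ y z B ≠ 0 := by
    rw [map_prod]
    exact Finset.prod_ne_zero_iff.2 fun i _ => hb i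
  let A' : Fin n → Polynomial (MvPolynomial s (PowerSeries k)) :=
    fun i => (∏ l ∈ Finset.univ.erase i, b l) * A i
  have hA' : ∀ i, langEv φ y z (A' i) = langEv φ y z B * x i := by
    intro i
    simp only [A', B, map_mul, hA, ← mul_assoc]
    rw [← map_mul, Finset.prod_erase_mul _ _ (Finset.mem_univ i)]
  have hev : ∀ {R : Type _} [CommRing R] (ψ : PowerSeries k →+* R) (y : s → R) (z : R),
      langEv ψ y z (MvPolynomial.eval₂ (Polynomial.C.comp MvPolynomial.C) A' f) =
      MvPolynomial.eval₂ ψ (fun i => langEv ψ y z (A' i)) f := by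
    intro R _ ψ y z
    rw [MvPolynomial.eval₂_comp_left]
    have h0 : (langEv ψ y z).comp (Polynomial.C.comp MvPolynomial.C) = ψ := by
      ext1 a
      simp [langEv]
    rw [h0]
    rfl
  have hP : langEv φ y z (MvPolynomial.eval₂ (Polynomial.C.comp MvPolynomial.C) A' f) = 0 := by
    rw [hev]
    have : (fun i => langEv φ y z (A' i)) = langEv φ y z B • x := by
      ext1 i
      exact hA' i
    rw [this, lang_eval₂_smul hf, hx, mul_zero]
  obtain ⟨Q, hQ, hGQ⟩ := hG3 _ hP
  obtain ⟨i, hi⟩ : ∃ i, x i ≠ 0 := Function.ne_iff.1 hx0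
  obtain ⟨y₀, z₀, h1, h2⟩ := lang_point G (Q * A' i) y z hG1 hG2 (by
    rw [map_mul, hA']
    exact mul_ne_zero hQ (mul_ne_zero hB hi))
  rw [map_mul] at h2
  refine ⟨fun i => langEv (RingHom.id _) y₀ z₀ (A' i), ?_, ?_⟩
  · exact Function.ne_iff.2 ⟨i, right_ne_zero_of_mul h2⟩
  · have h3 := map_dvd (langEv (RingHom.id _) y₀ z₀) hGQ
    rw [h1, zero_dvd_iff, map_mul, hev] at h3
    exact (mul_eq_zero.1 h3).resolve_left (left_ne_zero_of_mul h2)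

/-- **Lang's theorem**: for `k` algebraically closed, the field `k((t))` of formal Laurent
series over `k` is `C₁`: every homogeneous polynomial of degree `d > 0` in `n > d`
variables has a nontrivial zero. -/
theorem laurentSeries_C1 (k : Type*) [Field k] [IsAlgClosed k] (d n : ℕ) (hd : 0 < d)
    (hn : d < n)
    (f : MvPolynomial (Fin n) (LaurentSeries k))
    (hf : f.IsHomogeneous d) :
    ∃ x : Fin n → LaurentSeries k, x ≠ 0 ∧ MvPolynomial.eval x f = 0 := by
  obtain ⟨c, g, hc, hg⟩ := lang_clear (O := PowerSeries k) f
  have hinj : Function.Injective (algebraMap (PowerSeries k) (LaurentSeries k)) :=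
    IsFractionRing.injective _ _
  have hgh : g.IsHomogeneous d := by
    apply MvPolynomial.IsHomogeneous.of_map hinj
    rw [hg]
    simpa using (MvPolynomial.isHomogeneous_C (Fin n)
      (algebraMap (PowerSeries k) (LaurentSeries k) c)).mul hf
  obtain ⟨x, hx, h⟩ := lang_main d n hd hn g hgh
  refine ⟨fun i => algebraMap (PowerSeries k) (LaurentSeries k) (x i), ?_, ?_⟩
  · obtain ⟨i, hi⟩ := Function.ne_iff.1 hx
    refine Function.ne_iff.2 ⟨i, ?_⟩
    exact (map_ne_zero_iff _ hinj).2 hi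
  · have h1 : MvPolynomial.eval (fun i => algebraMap (PowerSeries k) (LaurentSeries k) (x i))
        (MvPolynomial.map (algebraMap (PowerSeries k) (LaurentSeries k)) g) = 0 := by
      rw [MvPolynomial.eval_map]
      have := MvPolynomial.eval₂_comp_left (algebraMap (PowerSeries k) (LaurentSeries k))
        (RingHom.id _) x g
      rw [RingHom.comp_id] at this
      change _ = MvPolynomial.eval₂ _ (fun i => _) g at this
      rw [show (fun i => algebraMap (PowerSeries k) (LaurentSeries k) (x i)) =
        algebraMap (PowerSeries k) (LaurentSeries k) ∘ x from rfl]
      refine Eq.trans this.symm ?_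
      change algebraMap (PowerSeries k) (LaurentSeries k) (MvPolynomial.eval x g) = 0
      rw [h, map_zero]
    rw [hg, map_mul, MvPolynomial.eval_C] at h1
    exact (mul_eq_zero.1 h1).resolve_left ((map_ne_zero_iff _ hinj).2 hc)
end

section
/- Let k be an algebraically closed field. Then the field k(t) of rational functions in one variable over k is C₁: every homogeneous polynomial over k(t) of degree d in n variables with n > d has a nontrivial zero over k(t). -/
open Polynomial in
/-- Substitution killing the variables in `T`. -/
noncomputable def tsenKill (k : Type*) [Field k] {σ : Type*} [DecidableEq σ] (T : Finset σ) :
    MvPolynomial σ k →ₐ[k] MvPolynomial σ k :=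
  MvPolynomial.aeval (fun i => if i ∈ T then 0 else MvPolynomial.X i)

theorem tsen_height (k : Type*) [Field k] {σ : Type*} [DecidableEq σ] (T : Finset σ) :
    (T.card : ℕ∞) ≤ (RingHom.ker (tsenKill k T)).height := by
  induction T using Finset.induction_on with
  | empty => simp
  | insert a T ha ih =>
    have h1 : (RingHom.ker (tsenKill k T)).IsPrime := RingHom.ker_isPrime _
    have h2 : (RingHom.ker (tsenKill k (insert a T))).IsPrime := RingHom.ker_isPrime _
    have hcomp : (tsenKill k (insert a T)).comp (tsenKill k T) = tsenKill k (insert a T) := by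
      apply MvPolynomial.algHom_ext
      intro i
      by_cases hi : i ∈ T <;> simp [tsenKill, hi]
    have hlt : RingHom.ker (tsenKill k T) < RingHom.ker (tsenKill k (insert a T)) := by
      refine lt_of_le_of_ne ?_ ?_
      · intro p hp
        rw [RingHom.mem_ker] at hp ⊢
        rw [← hcomp, AlgHom.comp_apply, hp, map_zero]
      · intro h
        have : (MvPolynomial.X a : MvPolynomial σ k) ∈ RingHom.ker (tsenKill k (insert a T)) := by
          simp [RingHom.mem_ker, tsenKill]
        rw [← h, RingHom.mem_ker] at this
        simp [tsenKill, ha] at this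
    have := Ideal.height_add_one_le_of_lt_of_isPrime hlt
    rw [Finset.card_insert_of_notMem ha]
    push_cast
    exact le_trans (by gcongr) this

/-- Fewer equations than variables, all vanishing at `0`: there is a nontrivial common zero. -/
theorem tsen_common_zero (k : Type*) [Field k] [IsAlgClosed k] {σ : Type*} [Fintype σ]
    (S : Finset (MvPolynomial σ k)) (hS : S.card < Fintype.card σ)
    (h0 : ∀ p ∈ S, MvPolynomial.eval 0 p = 0) :
    ∃ a : σ → k, a ≠ 0 ∧ ∀ p ∈ S, MvPolynomial.eval a p = 0 := by
  classical
  by_contra hcon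
  push Not at hcon
  have hz : MvPolynomial.zeroLocus k (Ideal.span (S : Set (MvPolynomial σ k))) = {0} := by
    rw [MvPolynomial.zeroLocus_span]
    ext x
    simp only [Set.mem_ofPred_eq, Set.mem_singleton_iff, Finset.mem_coe]
    constructor
    · intro hx
      by_contra hne
      obtain ⟨p, hp, hpx⟩ := hcon x hne
      exact hpx (by simpa [MvPolynomial.aeval_eq_eval] using hx p hp)
    · rintro rfl p hp
      simpa [MvPolynomial.aeval_eq_eval] using h0 p hp
  have hr := MvPolynomial.vanishingIdeal_zeroLocus_eq_radical (k := k) (K := k)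
    (Ideal.span (S : Set (MvPolynomial σ k)))
  rw [hz] at hr
  set M : Ideal (MvPolynomial σ k) := MvPolynomial.vanishingIdeal k {(0 : σ → k)} with hM
  have hMp : M.IsPrime := by rw [hM]; infer_instance
  have hmin : M ∈ (Ideal.span (S : Set (MvPolynomial σ k))).minimalPrimes := by
    rw [← Ideal.radical_minimalPrimes, ← hr, Ideal.minimalPrimes_eq_subsingleton_self]
    rfl
  have hle := Ideal.height_le_card_of_mem_minimalPrimes_span_finset hmin
  have hge : (Fintype.card σ : ℕ∞) ≤ M.height := by
    refine (tsen_height k (Finset.univ : Finset σ)).trans (Ideal.height_mono ?_)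
    intro p hp
    rw [RingHom.mem_ker] at hp
    rw [hM, MvPolynomial.mem_vanishingIdeal_singleton_iff]
    have hc : (MvPolynomial.aeval (0 : σ → k)).comp (tsenKill k (Finset.univ : Finset σ))
        = MvPolynomial.aeval (0 : σ → k) := by
      apply MvPolynomial.algHom_ext
      intro i
      simp [tsenKill]
    rw [← hc, AlgHom.comp_apply, hp, map_zero]
  have := hge.trans hle
  have h3 : Fintype.card σ ≤ S.card := by exact_mod_cast this
  omega

open Polynomial in
theorem tsen_poly (k : Type*) [Field k] [IsAlgClosed k] (d n : ℕ) (hd : 0 < d)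
    (hn : d < n) (g : MvPolynomial (Fin n) k[X]) (hg : g.totalDegree ≤ d)
    (hg0 : MvPolynomial.eval 0 g = 0) :
    ∃ x : Fin n → k[X], x ≠ 0 ∧ MvPolynomial.eval x g = 0 := by
  classical
  set c : ℕ := g.support.sup (fun m => (g.coeff m).natDegree) with hc
  let σ := Fin n × Fin (c + 1)
  let R := MvPolynomial σ k
  let y : Fin n → R[X] := fun i => ∑ j : Fin (c + 1), C (MvPolynomial.X (i, j)) * X ^ (j : ℕ)
  let F : R[X] := MvPolynomial.eval₂ (mapRingHom (MvPolynomial.C : k →+* R)) y g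
  let xx : (σ → k) → Fin n → k[X] := fun a i => ∑ j : Fin (c + 1), C (a (i, j)) * X ^ (j : ℕ)
  have hF : ∀ a : σ → k, F.map (MvPolynomial.eval a) = MvPolynomial.eval (xx a) g := by
    intro a
    change mapRingHom (MvPolynomial.eval a) (MvPolynomial.eval₂ _ y g) = _
    rw [MvPolynomial.hom_eval₂]
    change _ = MvPolynomial.eval₂ (RingHom.id _) (xx a) g
    congr 1
    · ext <;> simp
    · funext i
      simp [y, xx, Polynomial.map_sum]
  have hy : ∀ i, (y i).natDegree ≤ c := by
    intro i
    refine natDegree_sum_le_of_forall_le _ _ ?_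
    intro j _
    exact (natDegree_C_mul_X_pow_le _ _).trans (by omega)
  have hdeg : F.natDegree ≤ c + d * c := by
    change (MvPolynomial.eval₂ _ y g).natDegree ≤ _
    rw [MvPolynomial.eval₂_eq']
    refine natDegree_sum_le_of_forall_le _ _ ?_
    intro m hm
    refine natDegree_mul_le.trans (add_le_add ?_ ?_)
    · refine (natDegree_map_le).trans ?_
      exact Finset.le_sup (f := fun m => (g.coeff m).natDegree) hm
    · refine (natDegree_prod_le _ _).trans ?_
      calc ∑ i, (y i ^ m i).natDegree ≤ ∑ i, m i * c :=
            Finset.sum_le_sum fun i _ => natDegree_pow_le.trans (Nat.mul_le_mul_left _ (hy i))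
        _ = (∑ i, m i) * c := by rw [Finset.sum_mul]
        _ ≤ d * c := by
          refine Nat.mul_le_mul_right _ (le_trans ?_ hg)
          have := MvPolynomial.le_totalDegree hm
          rwa [Finsupp.sum_fintype _ _ (fun _ => rfl)] at this
  let S : Finset R := (Finset.range (c + d * c + 1)).image F.coeff
  have hcard : S.card < Fintype.card σ := by
    refine (Finset.card_image_le).trans_lt ?_
    simp only [Finset.card_range, σ, Fintype.card_prod, Fintype.card_fin]
    nlinarith [Nat.mul_le_mul_right (c + 1) (Nat.succ_le_of_lt hn)]
  obtain ⟨a, ha, haS⟩ := tsen_common_zero k S hcard (by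
    intro p hp
    obtain ⟨l, -, rfl⟩ := Finset.mem_image.1 hp
    have h := hF 0
    have h0 : xx 0 = 0 := by funext i; simp [xx]
    rw [h0, hg0] at h
    have := congrArg (fun q => q.coeff l) h
    simpa [coeff_map] using this)
  refine ⟨xx a, ?_, ?_⟩
  · intro h
    apply ha
    funext ⟨i, j⟩
    have h1 := congrArg (fun q => q.coeff (j : ℕ)) (congrFun h i)
    simpa [xx, finsetSum_coeff, coeff_X_pow, Fin.val_inj] using h1
  · rw [← hF]
    ext l
    rw [coeff_map, coeff_zero]
    by_cases hl : l < c + d * c + 1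
    · exact haS _ (Finset.mem_image_of_mem _ (Finset.mem_range.2 hl))
    · rw [coeff_eq_zero_of_natDegree_lt (by omega), map_zero]

/-- **Tsen's theorem**: for `k` algebraically closed, the field `k(t)` of rational
functions in one variable over `k` is `C₁`: every homogeneous polynomial of degree
`d > 0` in `n > d` variables has a nontrivial zero. -/
theorem ratFunc_C1 (k : Type*) [Field k] [IsAlgClosed k] (d n : ℕ) (hd : 0 < d)
    (hn : d < n)
    (f : MvPolynomial (Fin n) (RatFunc k))
    (hf : f.IsHomogeneous d) :
    ∃ x : Fin n → RatFunc k, x ≠ 0 ∧ MvPolynomial.eval x f = 0 := by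
  classical
  obtain ⟨b, hb⟩ := IsLocalization.exist_integer_multiples (nonZeroDivisors (Polynomial k))
    f.support (fun m => f.coeff m)
  choose! h hh using hb
  let g : MvPolynomial (Fin n) (Polynomial k) := ∑ m ∈ f.support, MvPolynomial.monomial m (h m)
  have hinj : Function.Injective (algebraMap (Polynomial k) (RatFunc k)) :=
    IsFractionRing.injective _ _
  have hmap : MvPolynomial.map (algebraMap (Polynomial k) (RatFunc k)) g
      = MvPolynomial.C (algebraMap (Polynomial k) (RatFunc k) b) * f := by
    conv_rhs => rw [f.as_sum]
    rw [map_sum, Finset.mul_sum]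
    refine Finset.sum_congr rfl fun m hm => ?_
    rw [MvPolynomial.map_monomial, hh m hm, MvPolynomial.C_mul_monomial, Algebra.smul_def]
  have hgh : g.IsHomogeneous d := by
    refine MvPolynomial.IsHomogeneous.sum _ _ _ fun m hm => ?_
    refine MvPolynomial.isHomogeneous_monomial _ ?_
    have := hf (MvPolynomial.mem_support_iff.1 hm)
    rw [Finsupp.degree_eq_weight_one]; exact this
  obtain ⟨x, hx, hxg⟩ := tsen_poly k d n hd hn g hgh.totalDegree_le (by
    have := hgh.coeff_eq_zero (d := 0) (by simp; omega)
    rw [MvPolynomial.eval_zero, MvPolynomial.constantCoeff_eq]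
    exact this)
  refine ⟨fun i => algebraMap _ _ (x i), ?_, ?_⟩
  · intro h
    apply hx
    funext i
    have := congrFun h i
    exact hinj (by simpa using this)
  · have h1 : MvPolynomial.eval (fun i => algebraMap _ (RatFunc k) (x i))
        (MvPolynomial.map (algebraMap (Polynomial k) (RatFunc k)) g) = 0 := by
      have h2 := congrArg (algebraMap (Polynomial k) (RatFunc k)) hxg
      change algebraMap (Polynomial k) (RatFunc k)
        (MvPolynomial.eval₂ (RingHom.id _) x g) = _ at h2
      rw [MvPolynomial.hom_eval₂, map_zero, RingHom.comp_id] at h2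
      rw [MvPolynomial.eval_map]
      exact h2
    rw [hmap, map_mul, MvPolynomial.eval_C] at h1
    refine (mul_eq_zero.1 h1).resolve_left ?_
    intro h2
    exact nonZeroDivisors.coe_ne_zero b (hinj (by simpa using h2))
end
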